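/- arXiv:1203.6303 — 3 statements merged into one kernel-verified Lean document; each statement's English description precedes it below -/
import Mathlib

section
/- Let K ⊆ ℝ^d be a nonempty compact set, p ∈ ℝ^d and μ > Ĥ(p). Suppose u : ℝ^d → ℝ is upper semicontinuous and v : ℝ^d → ℝ is lower semicontinuous, u is a viscosity subsolution of H(p+Du,y) ≤ μ in ℝ^d ∖ K, v is a viscosity supersolution of H(p+Dv,y) ≥ μ in ℝ^d ∖ K, and liminf_{|y|→∞} v(y)/|y| ≥ 0. Then sup_{ℝ^d} (u − v) = max_K (u − v). -/
open MeasureTheory Filter Topology Bornology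
open scoped RealInnerProductSpace NNReal

noncomputable section

/-- Euclidean space ℝ^d. -/
abbrev Ed (d : ℕ) := EuclideanSpace ℝ (Fin d)

/-- The set 𝓛 of globally Lipschitz real-valued functions on ℝ^d. -/
def LipFuns (d : ℕ) : Set (Ed d → ℝ) := {w | ∃ C : ℝ≥0, LipschitzWith C w}

/-- SL⁺ : Lipschitz functions sublinear from below, i.e. liminf_{|y|→∞} w(y)/|y| ≥ 0. -/
def SLplus (d : ℕ) : Set (Ed d → ℝ) :=
  {w | w ∈ LipFuns d ∧ ∀ ε : ℝ, 0 < ε → ∃ R : ℝ, ∀ y : Ed d, R ≤ ‖y‖ → -ε ≤ w y / ‖y‖}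

/-- SL⁻ : Lipschitz functions sublinear from above, i.e. limsup_{|y|→∞} w(y)/|y| ≤ 0. -/
def SLminus (d : ℕ) : Set (Ed d → ℝ) :=
  {w | w ∈ LipFuns d ∧ ∀ ε : ℝ, 0 < ε → ∃ R : ℝ, ∀ y : Ed d, R ≤ ‖y‖ → w y / ‖y‖ ≤ ε}

/-- 𝓢 : Lipschitz functions strictly sublinear at infinity. -/
def Scal (d : ℕ) : Set (Ed d → ℝ) := SLplus d ∩ SLminus d

/-- H̄₊(p) = inf_{w ∈ SL⁺} esssup_y H(p + Dw(y), y). -/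
def HbarPlus (d : ℕ) (H : Ed d → Ed d → ℝ) (p : Ed d) : ℝ :=
  sInf {t | ∃ w ∈ SLplus d, t = essSup (fun y => H (p + gradient w y) y) volume}

/-- H̄₋(p) = inf_{w ∈ SL⁻} esssup_y H(p + Dw(y), y). -/
def HbarMinus (d : ℕ) (H : Ed d → Ed d → ℝ) (p : Ed d) : ℝ :=
  sInf {t | ∃ w ∈ SLminus d, t = essSup (fun y => H (p + gradient w y) y) volume}

/-- Ĥ(p) = inf_{w ∈ 𝓢} esssup_y H(p + Dw(y), y). -/
def Hhat (d : ℕ) (H : Ed d → Ed d → ℝ) (p : Ed d) : ℝ :=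
  sInf {t | ∃ w ∈ Scal d, t = essSup (fun y => H (p + gradient w y) y) volume}

/-- H̄* = inf_{w ∈ 𝓛} esssup_y H(Dw(y), y). -/
def Hstar (d : ℕ) (H : Ed d → Ed d → ℝ) : ℝ :=
  sInf {t | ∃ w ∈ LipFuns d, t = essSup (fun y => H (gradient w y) y) volume}

/-- m_μ(y,x) = sup { w(y) − w(x) : w ∈ 𝓛, H(Dw,z) ≤ μ a.e. }. -/
def mMu (d : ℕ) (H : Ed d → Ed d → ℝ) (μ : ℝ) (y x : Ed d) : ℝ :=
  sSup {t | ∃ w ∈ LipFuns d, (∀ᵐ z ∂volume, H (gradient w z) z ≤ μ) ∧ t = w y - w x}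

/-- Viscosity subsolution of F(Du, y) ≤ μ in U. -/
def ViscSub (d : ℕ) (F : Ed d → Ed d → ℝ) (μ : ℝ) (U : Set (Ed d)) (u : Ed d → ℝ) : Prop :=
  ∀ (φ : Ed d → ℝ) (x₀ : Ed d), x₀ ∈ U → ContDiffAt ℝ 1 φ x₀ →
    IsLocalMaxOn (fun y => u y - φ y) U x₀ → F (gradient φ x₀) x₀ ≤ μ

/-- Viscosity supersolution of F(Dv, y) ≥ μ in U. -/
def ViscSuper (d : ℕ) (F : Ed d → Ed d → ℝ) (μ : ℝ) (U : Set (Ed d)) (v : Ed d → ℝ) : Prop :=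
  ∀ (φ : Ed d → ℝ) (x₀ : Ed d), x₀ ∈ U → ContDiffAt ℝ 1 φ x₀ →
    IsLocalMinOn (fun y => v y - φ y) U x₀ → μ ≤ F (gradient φ x₀) x₀ 

/-! ### Level sets -/

lemma level_convex {d : ℕ} (h : Ed d → ℝ) (hc : Continuous h)
    (hq : ∀ p q, h ((1/2 : ℝ) • (p + q)) ≤ max (h p) (h q)) (c : ℝ) :
    Convex ℝ {q | h q ≤ c} := by
  intro x hx y hy a b ha hb hab
  simp only [Set.mem_ofPred_eq] at hx hy ⊢
  let g : ℝ → Ed d := fun t => (1 - t) • x + t • y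
  have hg : Continuous g := by fun_prop
  have hT : IsClosed {t | h (g t) ≤ c} := isClosed_le (hc.comp hg) continuous_const
  have hmid : ∀ s t, h (g s) ≤ c → h (g t) ≤ c → h (g ((s+t)/2)) ≤ c := by
    intro s t hs ht
    have e : g ((s+t)/2) = (1/2 : ℝ) • (g s + g t) := by
      simp only [g]; module
    rw [e]
    exact (hq _ _).trans (max_le hs ht)
  have h0 : h (g 0) ≤ c := by simpa [g] using hx
  have h1 : h (g 1) ≤ c := by simpa [g] using hy
  have hb1 : b ≤ 1 := by linarith
  have eb : a • x + b • y = g b := by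
    have : a = 1 - b := by linarith
    simp only [g, this]
  rw [eb]
  obtain ⟨s, hs⟩ := ((isCompact_Icc (a := (0:ℝ)) (b := b)).inter_right hT).exists_isGreatest
    ⟨0, ⟨le_refl _, hb⟩, h0⟩
  obtain ⟨t, ht⟩ := ((isCompact_Icc (a := b) (b := (1:ℝ))).inter_right hT).exists_isLeast
    ⟨1, ⟨hb1, le_refl _⟩, h1⟩
  have hm := hmid s t hs.1.2 ht.1.2
  have s1 := hs.1.1.1
  have s2 := hs.1.1.2
  have t1 := ht.1.1.1
  have t2 := ht.1.1.2
  rcases le_total ((s+t)/2) b with hle | hle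
  · have := hs.2 ⟨⟨by linarith, hle⟩, hm⟩
    have : b = s := by linarith
    rw [this]; exact hs.1.2
  · have := ht.2 ⟨⟨hle, by linarith⟩, hm⟩
    have : b = t := by linarith
    rw [this]; exact ht.1.2

lemma strict_level {d : ℕ} (H : Ed d → Ed d → ℝ)
    (hHcont : Continuous fun q : Ed d × Ed d => H q.1 q.2)
    (hqc : ∀ p q y : Ed d, H ((1/2 : ℝ) • (p + q)) y ≤ max (H p y) (H q y))
    (Λ : ℝ → ℝ → ℝ)
    (hΛmono : ∀ a b a' b' : ℝ, a ≤ a' → b ≤ b' → Λ a b ≤ Λ a' b')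
    (hΛstrict : ∀ a b : ℝ, a ≠ b → Λ a b < max a b)
    (hsqc : ∀ p q y : Ed d, H ((1/2 : ℝ) • (p + q)) y ≤ Λ (H p y) (H q y))
    (μ μ₁ : ℝ) (hμ : μ₁ < μ) (n : ℕ) :
    ∃ ν, ν < μ ∧ ∀ q₁ q₂ y : Ed d, H q₁ y ≤ μ → H q₂ y ≤ μ₁ → ∀ t : ℝ, 0 ≤ t →
      t ≤ 1 - (1/2 : ℝ)^n → H (t • q₁ + (1 - t) • q₂) y ≤ ν := by
  have hconv : ∀ y c, Convex ℝ {q | H q y ≤ c} := fun y c =>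
    level_convex (fun q => H q y) (hHcont.comp (by fun_prop : Continuous fun q : Ed d => (q, y)))
      (fun p q => hqc p q y) c
  induction n with
  | zero =>
    refine ⟨μ₁, hμ, ?_⟩
    intro q₁ q₂ y h1 h2 t ht ht'
    have : t = 0 := by norm_num at ht'; linarith
    simpa [this] using h2
  | succ n ih =>
    obtain ⟨ν, hν, ih⟩ := ih
    refine ⟨max (Λ μ ν) (Λ μ μ₁), ?_, ?_⟩
    · apply max_lt
      · have := hΛstrict μ ν hν.ne'
        rwa [max_eq_left hν.le] at this
      · have := hΛstrict μ μ₁ hμ.ne'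
        rwa [max_eq_left hμ.le] at this
    intro q₁ q₂ y h1 h2 t ht ht'
    rcases le_total (1/2) t with h | h
    · have e : t • q₁ + (1 - t) • q₂ =
          (1/2 : ℝ) • (q₁ + ((2 * t - 1) • q₁ + (1 - (2 * t - 1)) • q₂)) := by module
      rw [e]
      refine (hsqc _ _ _).trans ((hΛmono _ _ _ _ h1 (ih q₁ q₂ y h1 h2 _ (by linarith) ?_)).trans
        (le_max_left _ _))
      rw [pow_succ] at ht'; linarith
    · have e : t • q₁ + (1 - t) • q₂ =
          (1/2 : ℝ) • (((2 * t) • q₁ + (1 - 2 * t) • q₂) + q₂) := by module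
      rw [e]
      refine (hsqc _ _ _).trans ((hΛmono _ _ _ _ ?_ h2).trans (le_max_right _ _))
      exact hconv y μ h1 (h2.trans hμ.le : H q₂ y ≤ μ) (by linarith) (by linarith) (by ring)

/-! ### Gradients -/

lemma grad_radial {d : ℕ} (a x : Ed d) (g : ℝ → ℝ) (g' : ℝ)
    (hg : HasDerivAt g g' (‖x - a‖^2)) :
    HasGradientAt (fun z : Ed d => g (‖z - a‖^2)) ((2 * g') • (x - a)) x := by
  rw [hasGradientAt_iff_hasFDerivAt]
  have h1 : HasFDerivAt (fun z : Ed d => z - a) (ContinuousLinearMap.id ℝ (Ed d)) x :=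
    (hasFDerivAt_id x).sub_const a
  have h2 := h1.norm_sq
  have h3 := hg.comp_hasFDerivAt x h2
  refine h3.congr_fderiv ?_
  ext v
  simp
  ring

lemma contDiffAt_radial {d : ℕ} (a x : Ed d) (g : ℝ → ℝ)
    (hg : ContDiffAt ℝ 1 g (‖x - a‖^2)) :
    ContDiffAt ℝ 1 (fun z : Ed d => g (‖z - a‖^2)) x := by
  have h2 : ContDiffAt ℝ 1 (fun z : Ed d => ‖z - a‖^2) x :=
    (contDiffAt_id.sub contDiffAt_const).norm_sq ℝ
  exact ContDiffAt.comp x hg h2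

lemma HasGradientAt.add' {d : ℕ} {f g : Ed d → ℝ} {f' g' x : Ed d} (hf : HasGradientAt f f' x)
    (hg : HasGradientAt g g' x) : HasGradientAt (fun z => f z + g z) (f' + g') x := by
  rw [hasGradientAt_iff_hasFDerivAt] at *
  rw [map_add]; exact hf.add hg

lemma HasGradientAt.smul' {d : ℕ} {f : Ed d → ℝ} {f' x : Ed d} (c : ℝ)
    (hf : HasGradientAt f f' x) : HasGradientAt (fun z => c * f z) (c • f') x := by
  rw [hasGradientAt_iff_hasFDerivAt] at *
  have := hf.const_mul c
  refine this.congr_fderiv ?_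
  ext v; simp

/-! ### Linear growth of subsolutions -/

lemma usc_le_on {d : ℕ} {f : Ed d → ℝ} (hf : UpperSemicontinuous f) {s : Set (Ed d)}
    (hs : IsCompact s) : ∃ M, ∀ x ∈ s, f x ≤ M := by
  rcases s.eq_empty_or_nonempty with rfl | hne
  · exact ⟨0, by simp⟩
  · obtain ⟨x, _, hx⟩ := (hf.upperSemicontinuousOn s).exists_isMaxOn hne hs
    exact ⟨f x, fun y hy => hx hy⟩

lemma sub_growth {d : ℕ} (F : Ed d → Ed d → ℝ) (μ L R₀ : ℝ) (hLpos : 0 < L) (hR₀ : 0 < R₀)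
    (hL : ∀ q y, L ≤ ‖q‖ → μ < F q y) (K : Set (Ed d)) (hKR : ∀ x ∈ K, ‖x‖ ≤ R₀)
    (u : Ed d → ℝ) (hu : UpperSemicontinuous u) (hsub : ViscSub d F μ Kᶜ u) :
    ∃ M, ∀ y, u y ≤ M + L * ‖y‖ := by
  obtain ⟨M₀, hM₀⟩ := usc_le_on hu (isCompact_closedBall (0 : Ed d) R₀)
  refine ⟨M₀, fun y => ?_⟩
  set R : ℝ := ‖y‖ + R₀ + 1 with hR
  have hy0 := norm_nonneg y
  have hRpos : 0 < R := by positivity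
  obtain ⟨M₁, hM₁⟩ := usc_le_on hu (isCompact_closedBall (0 : Ed d) R)
  set T : ℝ := max (M₁ - M₀) 0 with hT
  have hT0 : 0 ≤ T := le_max_right _ _
  have key : ∀ n : ℕ, u y ≤ M₀ + L * ‖y‖ + T * (‖y‖^2 / R^2)^n := by
    intro n
    let g : ℝ → ℝ := fun s => L * √s + T * (s / R^2)^n
    let φ : Ed d → ℝ := fun z => g (‖z - 0‖^2)
    have hφ : ∀ z, φ z = L * ‖z‖ + T * (‖z‖^2 / R^2)^n := by
      intro z; simp [φ, g]
    have hφc : Continuous φ := by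
      rw [show φ = fun z => L * ‖z‖ + T * (‖z‖^2 / R^2)^n from funext hφ]
      fun_prop
    have hφ0 : ∀ z, 0 ≤ φ z := by intro z; rw [hφ]; positivity
    have husc : UpperSemicontinuous (fun z => u z + (- φ z)) :=
      hu.add hφc.neg.upperSemicontinuous
    obtain ⟨x, hxR, hx⟩ := (husc.upperSemicontinuousOn (Metric.closedBall 0 R)).exists_isMaxOn
      ⟨0, by simp [hRpos.le]⟩ (isCompact_closedBall (0 : Ed d) R)
    have hxy := hx (show y ∈ Metric.closedBall (0 : Ed d) R by simp; linarith)
    simp only [Set.mem_ofPred_eq] at hxy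
    suffices hh : u x - φ x ≤ M₀ by
      have := hφ y; linarith
    simp only [mem_closedBall_zero_iff] at hxR
    rcases le_or_gt ‖x‖ R₀ with h | h
    · have := hM₀ x (by simpa using h)
      linarith [hφ0 x]
    rcases hxR.eq_or_lt with h' | h'
    · have h1 := hM₁ x (by simpa using hxR)
      have h2 := hφ x
      rw [h', div_self (by positivity), one_pow] at h2
      have := le_max_left (M₁ - M₀) 0
      have : 0 < L * R := by positivity
      linarith
    exfalso
    have hx0 : 0 < ‖x‖ := by linarith
    have hxK : x ∈ Kᶜ := fun hk => absurd (hKR x hk) (by linarith)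
    have hs0 : ‖x - 0‖^2 ≠ 0 := by simp; exact norm_pos_iff.1 hx0
    have hd1 : HasDerivAt g (L * (1 / (2 * √(‖x - 0‖^2))) +
        T * (n * (‖x - 0‖^2 / R^2)^(n-1) * (1 / R^2))) (‖x - 0‖^2) := by
      refine ((Real.hasDerivAt_sqrt hs0).const_mul L).add (HasDerivAt.const_mul T ?_)
      exact ((hasDerivAt_id _).div_const (R^2)).pow n
    have hgrad := (grad_radial 0 x g _ hd1).gradient
    have hC : ContDiffAt ℝ 1 g (‖x - 0‖^2) := by
      refine (contDiffAt_const.mul (Real.contDiffAt_sqrt hs0)).add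
        (contDiffAt_const.mul ((contDiffAt_id.div_const _).pow n))
    have hloc : IsLocalMaxOn (fun z => u z - φ z) Kᶜ x := by
      have : ∀ᶠ z in 𝓝 x, z ∈ Metric.closedBall (0 : Ed d) R :=
        Filter.mem_of_superset (Metric.isOpen_ball.mem_nhds (by simpa using h'))
          Metric.ball_subset_closedBall
      refine Filter.Eventually.filter_mono nhdsWithin_le_nhds ?_
      filter_upwards [this] with z hz
      have := hx hz
      simp only [Set.mem_ofPred_eq] at this
      linarith
    have h1 := hsub φ x hxK (contDiffAt_radial 0 x g hC) hloc
    refine absurd h1 (not_le.2 (hL _ _ ?_))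
    rw [show gradient φ x = _ from hgrad, norm_smul]
    simp only [sub_zero, Real.sqrt_sq (norm_nonneg x), Real.norm_eq_abs]
    set e := T * (n * (‖x‖^2 / R^2)^(n-1) * (1 / R^2)) with he
    have he0 : 0 ≤ e := by positivity
    rw [abs_of_nonneg (by positivity)]
    have : 2 * (L * (1 / (2 * ‖x‖)) + e) * ‖x‖ = L + 2 * e * ‖x‖ := by field_simp
    rw [this]
    have : 0 ≤ 2 * e * ‖x‖ := by positivity
    linarith
  have hlt : ‖y‖^2 / R^2 < 1 := by
    rw [div_lt_one (by positivity)]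
    exact pow_lt_pow_left₀ (by linarith) hy0 (by norm_num)
  have hlim : Tendsto (fun n : ℕ => M₀ + L * ‖y‖ + T * (‖y‖^2 / R^2)^n) atTop
      (𝓝 (M₀ + L * ‖y‖ + T * 0)) :=
    ((tendsto_pow_atTop_nhds_zero_of_lt_one (by positivity) hlt).const_mul T).const_add _
  have := ge_of_tendsto' hlim key
  simpa using this

/-! ### Smooth strict subsolutions -/

lemma norm_gradient_le {d : ℕ} {w : Ed d → ℝ} {C : ℝ≥0} (hw : LipschitzWith C w) (x : Ed d) :
    ‖gradient w x‖ ≤ C := by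
  have := norm_fderiv_le_of_lipschitz ℝ hw (x₀ := x)
  rwa [← toDual_gradient, LinearIsometryEquiv.norm_map] at this

lemma exists_ae_strict {d : ℕ} (H : Ed d → Ed d → ℝ)
    (hreg_bdd : ∀ R : ℝ, 0 < R → ∃ M : ℝ, ∀ p y : Ed d, ‖p‖ ≤ R → |H p y| ≤ M)
    (p : Ed d) (μ : ℝ) (hμ : Hhat d H p < μ) :
    ∃ w ∈ Scal d, ∃ μ', μ' < μ ∧ ∀ᵐ y ∂volume, H (p + gradient w y) y ≤ μ' := by
  have hne : {t | ∃ w ∈ Scal d, t = essSup (fun y => H (p + gradient w y) y) volume}.Nonempty := by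
    refine ⟨_, fun _ => 0, ⟨⟨⟨0, LipschitzWith.const 0⟩, ?_⟩, ⟨0, LipschitzWith.const 0⟩, ?_⟩, rfl⟩
    · intro ε hε; exact ⟨0, fun y _ => by simp [hε.le]⟩
    · intro ε hε; exact ⟨0, fun y _ => by simp [hε.le]⟩
  obtain ⟨t, ⟨w, hw, rfl⟩, ht⟩ := exists_lt_of_csInf_lt hne hμ
  refine ⟨w, hw, _, ht, ?_⟩
  obtain ⟨C, hC⟩ := hw.1.1
  obtain ⟨M, hM⟩ := hreg_bdd (‖p‖ + C + 1) (by positivity)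
  apply ae_le_essSup
  refine isBoundedUnder_of ⟨M, fun y => ?_⟩
  refine (le_abs_self _).trans (hM _ _ ?_)
  have := norm_add_le p (gradient w y)
  have := norm_gradient_le hC y
  linarith

lemma mollify {d : ℕ} (w : Ed d → ℝ) (C : ℝ≥0) (hw : LipschitzWith C w) (ρ : ℝ) (hρ : 0 < ρ) :
    ∃ w' : Ed d → ℝ, ContDiff ℝ 1 w' ∧ (∀ x, |w' x - w x| ≤ C * ρ) ∧
      ∀ x (s : Set (Ed d)), IsClosed s → Convex ℝ s →
        (∀ᵐ z ∂volume, ‖z - x‖ < ρ → gradient w z ∈ s) → gradient w' x ∈ s := by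
  let φ : ContDiffBump (0 : Ed d) := ⟨ρ/2, ρ, by positivity, by linarith⟩
  let k : Ed d → ℝ := φ.normed volume
  have hk0 : ∀ t, 0 ≤ k t := φ.nonneg_normed
  have hkc : Continuous k := φ.continuous_normed
  have hki : Integrable k volume := φ.integrable_normed
  have hk1 : ∫ t, k t = 1 := φ.integral_normed
  have hks : Function.support k = Metric.ball 0 ρ := φ.support_normed_eq
  have hkcs : HasCompactSupport k := φ.hasCompactSupport_normed
  let w' : Ed d → ℝ := MeasureTheory.convolution k w (ContinuousLinearMap.lsmul ℝ ℝ) volume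
  have hw' : ∀ x, w' x = ∫ t, k t * w (x - t) := fun x => by
    simp [w', MeasureTheory.convolution]
  refine ⟨w', ?_, ?_, ?_⟩
  · exact hkcs.contDiff_convolution_left (n := 1) _ (φ.contDiff_normed (n := 1))
      hw.continuous.locallyIntegrable
  · intro x
    have := φ.dist_normed_convolution_le (μ := volume) (g := w) (x₀ := x) (ε := C * ρ)
      hw.continuous.aestronglyMeasurable (fun z hz => (hw.dist_le_mul z x).trans
        (mul_le_mul_of_nonneg_left (le_of_lt hz) C.2))
    rwa [Real.dist_eq] at this
  · intro x s hs hsc hae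
    have hmp : MeasurePreserving (fun t : Ed d => x - t) volume volume :=
      Measure.measurePreserving_sub_left volume x
    have hdiff : ∀ᵐ t ∂(volume : Measure (Ed d)), DifferentiableAt ℝ w (x - t) :=
      hmp.quasiMeasurePreserving.ae hw.ae_differentiableAt
    have hae' : ∀ᵐ t ∂(volume : Measure (Ed d)), ‖(x - t) - x‖ < ρ → gradient w (x - t) ∈ s :=
      hmp.quasiMeasurePreserving.ae hae
    have hgm : Measurable (gradient w) := by
      have : gradient w = fun z => (InnerProductSpace.toDual ℝ (Ed d)).symm (fderiv ℝ w z) := rfl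
      rw [this]
      exact (LinearIsometryEquiv.continuous _).measurable.comp (measurable_fderiv ℝ w)
    have hder : HasFDerivAt (fun z => ∫ t, k t * w (z - t))
        (∫ t, k t • fderiv ℝ w (x - t)) x := by
      refine (hasFDerivAt_integral_of_dominated_loc_of_lip (F := fun z t => k t * w (z - t))
        (F' := fun t => k t • fderiv ℝ w (x - t)) (bound := fun t => C * k t) (s := Set.univ)
        Filter.univ_mem ?_ ?_ ?_ ?_ ?_ ?_).2
      · refine Filter.Eventually.of_forall fun z => Continuous.aestronglyMeasurable ?_
        exact hkc.mul (hw.continuous.comp (by fun_prop))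
      · refine Continuous.integrable_of_hasCompactSupport
          (hkc.mul (hw.continuous.comp (by fun_prop))) hkcs.mul_right
      · refine (hkc.measurable.smul ((measurable_fderiv ℝ w).comp ?_)).aestronglyMeasurable
        fun_prop
      · refine Filter.Eventually.of_forall fun t => LipschitzWith.lipschitzOnWith ?_
        refine LipschitzWith.of_dist_le_mul fun a b => ?_
        have h1 := hw.dist_le_mul (a - t) (b - t)
        rw [dist_sub_right] at h1
        rw [Real.dist_eq, ← mul_sub, abs_mul, abs_of_nonneg (hk0 t), ← Real.dist_eq]
        have h2 : ((Real.nnabs (C * k t) : ℝ≥0) : ℝ) = C * k t := by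
          rw [Real.coe_nnabs]; exact abs_of_nonneg (mul_nonneg C.2 (hk0 t))
        rw [h2]
        calc _ ≤ k t * (C * dist a b) := mul_le_mul_of_nonneg_left h1 (hk0 t)
          _ = _ := by ring
      · exact hki.const_mul _
      · filter_upwards [hdiff] with t ht
        have h1 : HasFDerivAt (fun z : Ed d => w (z - t)) (fderiv ℝ w (x - t)) x :=
          by
          have h2 := HasFDerivAt.comp x ht.hasFDerivAt ((hasFDerivAt_id x).sub_const t)
          simpa [Function.comp_def] using h2
        exact h1.const_mul (k t)
    have hgi : Integrable (fun t => k t • gradient w (x - t)) volume := by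
      refine Integrable.mono' (hki.mul_const (C : ℝ)) ?_ ?_
      · refine (hkc.measurable.smul (hgm.comp ?_)).aestronglyMeasurable
        fun_prop
      · refine Filter.Eventually.of_forall fun t => ?_
        rw [norm_smul, Real.norm_eq_abs, abs_of_nonneg (hk0 t)]
        exact mul_le_mul_of_nonneg_left (norm_gradient_le hw _) (hk0 t)
    have hgrad : HasGradientAt w' (∫ t, k t • gradient w (x - t)) x := by
      rw [hasGradientAt_iff_hasFDerivAt]
      have e : (InnerProductSpace.toDual ℝ (Ed d)) (∫ t, k t • gradient w (x - t)) =
          ∫ t, k t • fderiv ℝ w (x - t) := by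
        have h1 := ((InnerProductSpace.toDual ℝ (Ed d)).toContinuousLinearEquiv.integral_comp_comm
          (μ := volume) (fun t => k t • gradient w (x - t)))
        have h2 : ∀ t, (InnerProductSpace.toDual ℝ (Ed d)) (k t • gradient w (x - t)) =
            k t • fderiv ℝ w (x - t) := fun t => by
          rw [← toDual_gradient]; simp
        simp only [← h2]
        exact h1.symm
      rw [e]
      rwa [show w' = _ from funext hw']
    rw [hgrad.gradient]
    let kn : Ed d → ℝ≥0 := fun t => ⟨k t, hk0 t⟩
    have hknm : Measurable kn := hkc.measurable.subtype_mk
    let ν : Measure (Ed d) := volume.withDensity (fun t => (kn t : ENNReal))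
    have hν : IsProbabilityMeasure ν := by
      constructor
      rw [withDensity_apply _ MeasurableSet.univ, Measure.restrict_univ]
      have : ∀ t, (kn t : ENNReal) = ENNReal.ofReal (k t) := fun t => by
        rw [ENNReal.ofReal_eq_coe_nnreal (hk0 t)]; rfl
      simp_rw [this]
      rw [← ofReal_integral_eq_lintegral_ofReal hki (Filter.Eventually.of_forall hk0), hk1]
      simp
    have e := integral_withDensity_eq_integral_smul (μ := (volume : Measure (Ed d))) hknm
      (fun t => gradient w (x - t))
    have e' : ∫ t, k t • gradient w (x - t) = ∫ t, gradient w (x - t) ∂ν := e.symm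
    rw [e']
    refine hsc.integral_mem hs ?_ ?_
    · rw [ae_withDensity_iff (by fun_prop)]
      filter_upwards [hae'] with t ht hkt
      apply ht
      have : t ∈ Function.support k := by
        intro h0; apply hkt
        have : kn t = 0 := Subtype.ext h0
        simp [this]
      rw [hks] at this
      simpa using this
    · exact (integrable_withDensity_iff_integrable_smul hknm).2 hgi

lemma exists_smooth_strict {d : ℕ} (H : Ed d → Ed d → ℝ)
    (hHcont : Continuous fun q : Ed d × Ed d => H q.1 q.2)
    (hreg_bdd : ∀ R : ℝ, 0 < R → ∃ M : ℝ, ∀ p y : Ed d, ‖p‖ ≤ R → |H p y| ≤ M)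
    (hreg_uc : ∀ R : ℝ, 0 < R → ∀ ε : ℝ, 0 < ε → ∃ δ : ℝ, 0 < δ ∧ ∀ p p' y y' : Ed d,
      ‖p‖ ≤ R → ‖p'‖ ≤ R → ‖p - p'‖ < δ → ‖y - y'‖ < δ → |H p y - H p' y'| < ε)
    (hqc : ∀ p q y : Ed d, H ((1/2 : ℝ) • (p + q)) y ≤ max (H p y) (H q y))
    (p : Ed d) (μ : ℝ) (hμ : Hhat d H p < μ) :
    ∃ w : Ed d → ℝ, ContDiff ℝ 1 w ∧ (∃ μ₁, μ₁ < μ ∧ ∀ y, H (p + gradient w y) y ≤ μ₁) ∧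
      (∃ C, ∀ y, -(C * (1 + ‖y‖)) ≤ w y) ∧
      (∀ ε : ℝ, 0 < ε → ∃ C, ∀ y, w y ≤ C + ε * ‖y‖) := by
  obtain ⟨w, hw, μ', hμ', hae⟩ := exists_ae_strict H hreg_bdd p μ hμ
  obtain ⟨C, hC⟩ := hw.1.1
  obtain ⟨ρ, hρ, hδ⟩ := hreg_uc (‖p‖ + C + 1) (by positivity) ((μ - μ')/2) (by linarith)
  obtain ⟨w', hw'1, hw'2, hw'3⟩ := mollify w C hC ρ hρ
  have hlip : ∀ y, |w y - w 0| ≤ C * ‖y‖ := fun y => by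
    have := hC.dist_le_mul y 0
    rwa [Real.dist_eq, dist_zero_right] at this
  refine ⟨w', hw'1, ⟨(μ + μ')/2, by linarith, fun y => ?_⟩, ?_, ?_⟩
  · have := hw'3 y {q | H (p + q) y ≤ (μ + μ')/2} ?_ ?_ ?_
    · exact this
    · exact isClosed_le (hHcont.comp (by fun_prop : Continuous fun q : Ed d => (p + q, y)))
        continuous_const
    · refine level_convex (fun q => H (p + q) y)
        (hHcont.comp (by fun_prop : Continuous fun q : Ed d => (p + q, y))) ?_ _
      intro a b
      have := hqc (p + a) (p + b) y
      have e : (1/2 : ℝ) • (p + a + (p + b)) = p + (1/2 : ℝ) • (a + b) := by module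
      rwa [e] at this
    · filter_upwards [hae] with z hz hzy
      have hb : ‖p + gradient w z‖ ≤ ‖p‖ + C + 1 := by
        have := norm_add_le p (gradient w z)
        have := norm_gradient_le hC z
        linarith
      have := hδ (p + gradient w z) (p + gradient w z) y z hb hb (by simpa using hρ)
        (by rwa [norm_sub_rev])
      have := (abs_lt.1 this).2
      show H (p + gradient w z) y ≤ _
      linarith
  · refine ⟨C * ρ + |w 0| + C, fun y => ?_⟩
    have h1 := (abs_le.1 (hw'2 y)).1
    have h2 := (abs_le.1 (hlip y)).1
    have h3 := neg_abs_le (w 0)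
    have h4 := norm_nonneg y
    have h5 : 0 ≤ (C : ℝ) := C.2
    have h6 : 0 ≤ (C * ρ + |w 0|) * ‖y‖ := by positivity
    nlinarith
  · intro ε hε
    obtain ⟨R, hR⟩ := hw.2.2 ε hε
    refine ⟨C * ρ + |w 0| + C * |R|, fun y => ?_⟩
    have h1 := (abs_le.1 (hw'2 y)).2
    have h5 : 0 ≤ (C : ℝ) := C.2
    have h6 := abs_nonneg (w 0)
    have h7 : 0 ≤ C * |R| := by positivity
    rcases le_total R ‖y‖ with h | h
    · have h2 := hR y h
      rcases (norm_nonneg y).eq_or_lt with h0 | h0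
      · have h3 := (abs_le.1 (hlip y)).2
        rw [← h0] at h3 ⊢
        have := le_abs_self (w 0)
        linarith
      · rw [div_le_iff₀ h0] at h2
        linarith
    · have h3 := (abs_le.1 (hlip y)).2
      have : C * ‖y‖ ≤ C * |R| := mul_le_mul_of_nonneg_left (h.trans (le_abs_self R)) h5
      have := le_abs_self (w 0)
      have : 0 ≤ ε * ‖y‖ := by positivity
      linarith

/-! ### Doubling of variables -/

lemma core {d : ℕ} (H : Ed d → Ed d → ℝ) (p : Ed d) (μ ν η b δ M R : ℝ)
    (K : Set (Ed d)) (hK : IsCompact K) (u v w ψ : Ed d → ℝ) (ψ' : Ed d → Ed d)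
    (hu : UpperSemicontinuous u) (hv : LowerSemicontinuous v)
    (husub : ViscSub d (fun q y => H (p + q) y) μ Kᶜ u)
    (hvsuper : ViscSuper d (fun q y => H (p + q) y) μ Kᶜ v)
    (hw : ContDiff ℝ 1 w) (hψ : ContDiff ℝ 1 ψ) (hψ' : ∀ x, HasGradientAt ψ (ψ' x) x)
    (hb : ∀ x, ‖ψ' x‖ ≤ b) (hη : 0 < η)
    (hstrict : ∀ q y, H (p + q) y ≤ μ → H (η • (p + q) + (1 - η) • (p + gradient w y)) y ≤ ν)
    (hδ : 0 < δ)
    (hcomp : ∀ Q Q' x y, H Q' x ≤ ν → ‖Q - Q'‖ ≤ b → ‖x - y‖ < δ → H Q y < μ)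
    (hMK : ∀ y ∈ K, η * u y + (1 - η) * w y - ψ y - v y ≤ M)
    (hMR : ∀ y, R ≤ ‖y‖ → η * u y + (1 - η) * w y - ψ y - v y ≤ M) :
    ∀ y, η * u y + (1 - η) * w y - ψ y - v y ≤ M := by
  by_contra hcon
  push Not at hcon
  obtain ⟨y₁, hy₁⟩ := hcon
  set m := η * u y₁ + (1 - η) * w y₁ - ψ y₁ - v y₁ with hm
  let f : Ed d → ℝ := fun x => η * u x + ((1 - η) * w x - ψ x)
  have hf : UpperSemicontinuous f := by
    have h1 : UpperSemicontinuous (fun x => η * u x) := by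
      have hc : Continuous (fun t : ℝ => η * t) := by fun_prop
      exact hc.comp_upperSemicontinuous hu (fun a b hab => mul_le_mul_of_nonneg_left hab hη.le)
    have h2 : Continuous (fun x => (1 - η) * w x - ψ x) :=
      (continuous_const.mul hw.continuous).sub hψ.continuous
    exact h1.add h2.upperSemicontinuous
  have hv' : UpperSemicontinuous (fun y => - v y) := by
    have hc : Continuous (fun t : ℝ => -t) := by fun_prop
    exact hc.comp_lowerSemicontinuous_antitone hv (fun a b hab => neg_le_neg hab)
  let G : Ed d × Ed d → ℝ := fun z => f z.1 + (- v z.2)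
  have hG : UpperSemicontinuous G :=
    (UpperSemicontinuous.comp hf continuous_fst).add (UpperSemicontinuous.comp (f := fun y => - v y) hv' continuous_snd)
  set R' := max R ‖y₁‖ + 1 with hR'
  have hRR : R < R' := by have := le_max_left R ‖y₁‖; linarith
  have hyR : ‖y₁‖ < R' := by have := le_max_right R ‖y₁‖; linarith
  let B : Set (Ed d × Ed d) := Metric.closedBall (0 : Ed d) R' ×ˢ Metric.closedBall (0 : Ed d) R'
  have hBc : IsCompact B := (isCompact_closedBall _ _).prod (isCompact_closedBall _ _)
  have hB1 : (y₁, y₁) ∈ B := by simp [B, hyR.le]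
  have hmax : ∀ n : ℕ, ∃ z ∈ B, ∀ z' ∈ B,
      G z' - n / 2 * ‖z'.1 - z'.2‖^2 ≤ G z - n / 2 * ‖z.1 - z.2‖^2 := by
    intro n
    have hc : Continuous (fun z : Ed d × Ed d => - ((n : ℝ) / 2 * ‖z.1 - z.2‖^2)) := by fun_prop
    have := hG.add hc.upperSemicontinuous
    obtain ⟨z, hz, hzm⟩ := (this.upperSemicontinuousOn B).exists_isMaxOn ⟨_, hB1⟩ hBc
    exact ⟨z, hz, fun z' hz' => by simpa [sub_eq_add_neg] using hzm hz'⟩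
  choose z hzB hzmax using hmax
  obtain ⟨D, hD⟩ : ∃ D, ∀ z ∈ B, G z ≤ D := by
    obtain ⟨z, _, hz⟩ := (hG.upperSemicontinuousOn B).exists_isMaxOn ⟨_, hB1⟩ hBc
    exact ⟨G z, fun y hy => hz hy⟩
  have hGm : ∀ n, m + n / 2 * ‖(z n).1 - (z n).2‖^2 ≤ G (z n) := by
    intro n
    have := hzmax n _ hB1
    have e : G (y₁, y₁) = m := by simp only [G, f, hm]; ring
    simp only [sub_self, norm_zero] at this
    rw [e] at this
    linarith
  obtain ⟨⟨a, a'⟩, haB, φ, hφ, hlim⟩ := hBc.tendsto_subseq hzB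
  have hl1 : Tendsto (fun n => (z (φ n)).1) atTop (𝓝 a) := (continuous_fst.tendsto _).comp hlim
  have hl2 : Tendsto (fun n => (z (φ n)).2) atTop (𝓝 a') := (continuous_snd.tendsto _).comp hlim
  have haa : a = a' := by
    have h1 : Tendsto (fun n => ‖(z (φ n)).1 - (z (φ n)).2‖^2) atTop (𝓝 (‖a - a'‖^2)) :=
      ((hl1.sub hl2).norm).pow 2
    have h2 : Tendsto (fun n => (2 * (D - m)) / (φ n : ℝ)) atTop (𝓝 0) :=
      (tendsto_const_nhds.div_atTop
        (tendsto_natCast_atTop_atTop.comp hφ.tendsto_atTop))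
    have h3 : ‖a - a'‖^2 ≤ 0 := by
      refine le_of_tendsto_of_tendsto h1 h2 ?_
      filter_upwards [eventually_gt_atTop 0] with n hn
      have hpos : (0 : ℝ) < φ n := by
        have := hφ.id_le n
        simp only [id] at this
        exact_mod_cast lt_of_lt_of_le hn this
      rw [le_div_iff₀ hpos]
      have h4 := hGm (φ n)
      have h5 := hD _ (hzB (φ n))
      linarith
    have : ‖a - a'‖ = 0 := by nlinarith [norm_nonneg (a - a')]
    exact sub_eq_zero.1 (norm_eq_zero.1 this)
  subst haa
  have hGa : m ≤ G (a, a) := by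
    have hcl : IsClosed {z | m ≤ G z} := hG.isClosed_preimage m
    refine hcl.mem_of_tendsto hlim (Filter.Eventually.of_forall fun n => ?_)
    have := hGm (φ n)
    have h0 : 0 ≤ (φ n : ℝ) / 2 * ‖(z (φ n)).1 - (z (φ n)).2‖^2 := by positivity
    show m ≤ G (z (φ n))
    linarith
  have hGa' : M < η * u a + (1 - η) * w a - ψ a - v a := by
    have e : G (a, a) = η * u a + (1 - η) * w a - ψ a - v a := by simp only [G, f]; ring
    linarith
  have haK : a ∈ Kᶜ := fun h => absurd (hMK a h) (not_le.2 hGa')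
  have haR : ‖a‖ < R := by
    by_contra h
    exact absurd (hMR a (not_lt.1 h)) (not_le.2 hGa')
  have hU : Kᶜ ∩ Metric.ball (0 : Ed d) R' ∈ 𝓝 a :=
    (hK.isClosed.isOpen_compl.inter Metric.isOpen_ball).mem_nhds ⟨haK, by simp; linarith⟩
  have hdd : ∀ᶠ n in atTop, ‖(z (φ n)).1 - (z (φ n)).2‖ < δ := by
    have : Tendsto (fun n => ‖(z (φ n)).1 - (z (φ n)).2‖) atTop (𝓝 0) := by
      simpa using (hl1.sub hl2).norm
    exact this.eventually_lt_const hδ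
  obtain ⟨n, ⟨hn1, hn2⟩, hn3⟩ := ((hl1.eventually hU).and (hl2.eventually hU)).and hdd |>.exists
  set N : ℝ := (φ n : ℝ) with hN
  have hmx := hzmax (φ n)
  rw [← hN] at hmx
  generalize hz0 : z (φ n) = zz at *
  obtain ⟨x, y⟩ := zz
  simp only at hn1 hn2 hn3 hmx
  have hball : ∀ c : Ed d, c ∈ Metric.ball (0 : Ed d) R' →
      ∀ᶠ z in 𝓝[Kᶜ] c, z ∈ Metric.closedBall (0 : Ed d) R' := fun c hc =>
    nhdsWithin_le_nhds (Filter.mem_of_superset (Metric.isOpen_ball.mem_nhds hc)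
      Metric.ball_subset_closedBall)
  -- test for the supersolution
  have hsup : μ ≤ H (p + N • (x - y)) y := by
    let χ : Ed d → ℝ := fun z => (fun s : ℝ => (-(N / 2)) * s) (‖z - x‖^2)
    have hg : HasGradientAt χ ((2 * (-(N / 2))) • (y - x)) y :=
      grad_radial x y _ _ (by
        have := (hasDerivAt_id (‖y - x‖^2)).const_mul (-(N / 2))
        rw [mul_one] at this; exact this)
    have := hvsuper χ y hn2.1 (contDiffAt_radial x y _ (by fun_prop)) ?_
    · rw [hg.gradient] at this
      have e : (2 * (-(N / 2))) • (y - x) = N • (x - y) := by module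
      rwa [e] at this
    · filter_upwards [hball y hn2.2] with z hz
      have := hmx (x, z) ⟨Metric.ball_subset_closedBall hn1.2, hz⟩
      simp only [G, χ] at this ⊢
      rw [norm_sub_rev x z, norm_sub_rev x y] at this
      linarith
  -- test for the subsolution
  let q : Ed d := η⁻¹ • ((N • (x - y) + ψ' x) + (-(1 - η)) • gradient w x)
  have hsb : H (p + q) x ≤ μ := by
    let χ₁ : Ed d → ℝ := fun z => (fun s : ℝ => (N / 2) * s) (‖z - y‖^2)
    have hg1 : HasGradientAt χ₁ ((2 * (N / 2)) • (x - y)) x :=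
      grad_radial y x _ _ (by
        have := (hasDerivAt_id (‖x - y‖^2)).const_mul (N / 2)
        rw [mul_one] at this; exact this)
    let χ : Ed d → ℝ := fun z => η⁻¹ * ((χ₁ z + ψ z) + (-(1 - η)) * w z)
    have hgw : HasGradientAt w (gradient w x) x :=
      (hw.differentiable (by norm_num) x).hasGradientAt
    have hg : HasGradientAt χ _ x := ((hg1.add' (hψ' x)).add' (hgw.smul' (-(1 - η)))).smul' η⁻¹
    have hc : ContDiffAt ℝ 1 χ x :=
      contDiffAt_const.mul (((contDiffAt_radial y x _ (contDiffAt_const.mul contDiffAt_id)).add hψ.contDiffAt).add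
        (contDiffAt_const.mul hw.contDiffAt))
    have := husub χ x hn1.1 hc ?_
    · rw [hg.gradient] at this
      have e : η⁻¹ • ((2 * (N / 2)) • (x - y) + ψ' x + -(1 - η) • gradient w x) = q := by
        simp only [q]; congr 4; ring
      rwa [e] at this
    · filter_upwards [hball x hn1.2] with z hz
      have := hmx (z, y) ⟨hz, Metric.ball_subset_closedBall hn2.2⟩
      simp only [G, f] at this
      have h1 : ∀ z, u z - χ z = η⁻¹ * (η * u z - ((χ₁ z + ψ z) + (-(1 - η)) * w z)) := by
        intro z; simp only [χ]; field_simp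
      show u z - χ z ≤ u x - χ x
      rw [h1 z, h1 x]
      refine mul_le_mul_of_nonneg_left ?_ (inv_nonneg.2 hη.le)
      simp only [χ₁]
      linarith
  have hQ := hstrict q x hsb
  have e : η • (p + q) + (1 - η) • (p + gradient w x) = p + N • (x - y) + ψ' x := by
    have : η • q = (N • (x - y) + ψ' x) + (-(1 - η)) • gradient w x := by
      simp only [q]; rw [smul_smul, mul_inv_cancel₀ hη.ne', one_smul]
    rw [smul_add, this]; module
  rw [e] at hQ
  refine absurd hsup (not_le.2 (hcomp _ _ x y hQ ?_ hn3))
  simpa using hb x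

lemma penalized {d : ℕ} (H : Ed d → Ed d → ℝ) (p : Ed d) (μ ν η b δ M C c : ℝ)
    (K : Set (Ed d)) (hK : IsCompact K) (u v w : Ed d → ℝ)
    (hu : UpperSemicontinuous u) (hv : LowerSemicontinuous v)
    (husub : ViscSub d (fun q y => H (p + q) y) μ Kᶜ u)
    (hvsuper : ViscSuper d (fun q y => H (p + q) y) μ Kᶜ v)
    (hw : ContDiff ℝ 1 w) (hb : 0 < b) (hη : 0 < η)
    (hstrict : ∀ q y, H (p + q) y ≤ μ → H (η • (p + q) + (1 - η) • (p + gradient w y)) y ≤ ν)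
    (hδ : 0 < δ)
    (hcomp : ∀ Q Q' x y, H Q' x ≤ ν → ‖Q - Q'‖ ≤ b → ‖x - y‖ < δ → H Q y < μ)
    (hc : c < b) (hgrow : ∀ y, η * u y + (1 - η) * w y - v y ≤ C + c * ‖y‖)
    (hMK : ∀ y ∈ K, η * u y + (1 - η) * w y - v y ≤ M) :
    ∀ y, η * u y + (1 - η) * w y - v y ≤ M := by
  have key : ∀ S : ℝ, 0 < S → ∀ y,
      η * u y + (1 - η) * w y - v y ≤ M + b * (√(S^2 + ‖y‖^2) - S) := by
    intro S hS
    let g : ℝ → ℝ := fun s => b * (√(S^2 + s) - S)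
    let ψ : Ed d → ℝ := fun z => g (‖z - 0‖^2)
    have hψe : ∀ z, ψ z = b * (√(S^2 + ‖z‖^2) - S) := fun z => by simp [ψ, g]
    have hpos : ∀ z : Ed d, 0 < S^2 + ‖z - 0‖^2 := fun z => by positivity
    have hgc : ∀ z : Ed d, ContDiffAt ℝ 1 g (‖z - 0‖^2) := fun z =>
      contDiffAt_const.mul (((contDiffAt_const.add contDiffAt_id).sqrt (hpos z).ne').sub
        contDiffAt_const)
    have hgd : ∀ z : Ed d, HasDerivAt g (b * (1 / (2 * √(S^2 + ‖z - 0‖^2)))) (‖z - 0‖^2) :=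
      fun z => (((hasDerivAt_id _).const_add (S^2)).sqrt (hpos z).ne' |>.sub_const S).const_mul b
    have hψ0 : ∀ z, 0 ≤ ψ z := fun z => by
      rw [hψe]
      refine mul_nonneg hb.le (sub_nonneg.2 (Real.le_sqrt_of_sq_le ?_))
      nlinarith [norm_nonneg z]
    have hψ1 : ∀ z, b * (‖z‖ - S) ≤ ψ z := fun z => by
      rw [hψe]
      refine mul_le_mul_of_nonneg_left (sub_le_sub_right (Real.le_sqrt_of_sq_le ?_) S) hb.le
      nlinarith
    have := core H p μ ν η b δ M ((C + b * S - M) / (b - c)) K hK u v w ψ _ hu hv husub hvsuper hw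
      (contDiff_iff_contDiffAt.2 fun z => contDiffAt_radial 0 z g (hgc z))
      (fun z => grad_radial 0 z g _ (hgd z)) ?_ hη hstrict hδ hcomp ?_ ?_
    · intro y
      have h1 := this y
      have h2 := hψe y
      linarith
    · intro z
      rw [norm_smul, Real.norm_eq_abs, sub_zero, abs_of_nonneg (by positivity)]
      have hs : ‖z‖ ≤ √(S^2 + ‖z‖^2) := Real.le_sqrt_of_sq_le (by nlinarith)
      have hs0 : 0 < √(S^2 + ‖z‖^2) := Real.sqrt_pos.2 (by positivity)
      have e : 2 * (b * (1 / (2 * √(S^2 + ‖z‖^2)))) * ‖z‖ = b * (‖z‖ / √(S^2 + ‖z‖^2)) := by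
        field_simp
      rw [e]
      have := (div_le_one hs0).2 hs
      nlinarith
    · intro y hy
      have := hMK y hy
      have := hψ0 y
      linarith
    · intro y hy
      rw [div_le_iff₀ (by linarith)] at hy
      have := hgrow y
      have := hψ1 y
      nlinarith
  intro y
  have hle : ∀ n : ℕ, η * u y + (1 - η) * w y - v y ≤ M + b * (‖y‖^2 / ((n : ℝ) + 1)) := by
    intro n
    have hn : (0 : ℝ) < (n : ℝ) + 1 := by positivity
    refine (key _ hn y).trans ?_
    have : √(((n : ℝ) + 1)^2 + ‖y‖^2) ≤ ((n : ℝ) + 1) + ‖y‖^2 / ((n : ℝ) + 1) := by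
      apply Real.sqrt_le_iff.2
      refine ⟨by positivity, ?_⟩
      have e : (((n : ℝ) + 1) + ‖y‖^2 / ((n : ℝ) + 1))^2 =
          ((n : ℝ) + 1)^2 + 2 * ‖y‖^2 + (‖y‖^2 / ((n : ℝ) + 1))^2 := by
        field_simp
        ring
      rw [e]
      have : 0 ≤ (‖y‖^2 / ((n : ℝ) + 1))^2 := by positivity
      nlinarith [sq_nonneg ‖y‖]
    have := mul_le_mul_of_nonneg_left (sub_le_sub_right this ((n : ℝ) + 1)) hb.le
    rw [add_sub_cancel_left] at this
    linarith
  have hlim : Tendsto (fun n : ℕ => M + b * (‖y‖^2 / ((n : ℝ) + 1))) atTop (𝓝 (M + b * 0)) :=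
    ((tendsto_const_nhds.div_atTop
      (tendsto_natCast_atTop_atTop.atTop_add tendsto_const_nhds)).const_mul b).const_add M
  simpa using ge_of_tendsto' hlim hle

/-- comparison principle for the exterior problem. -/
theorem statement_5
    (d : ℕ) (hd : 0 < d)
    (H : Ed d → Ed d → ℝ)
    (hHcont : Continuous fun q : Ed d × Ed d => H q.1 q.2)
    (hreg_bdd : ∀ R : ℝ, 0 < R → ∃ M : ℝ, ∀ p y : Ed d, ‖p‖ ≤ R → |H p y| ≤ M)
    (hreg_uc : ∀ R : ℝ, 0 < R → ∀ ε : ℝ, 0 < ε → ∃ δ : ℝ, 0 < δ ∧ ∀ p p' y y' : Ed d,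
      ‖p‖ ≤ R → ‖p'‖ ≤ R → ‖p - p'‖ < δ → ‖y - y'‖ < δ → |H p y - H p' y'| < ε)
    (hcoer : ∀ M : ℝ, ∃ R : ℝ, ∀ p y : Ed d, R ≤ ‖p‖ → M ≤ H p y)
    (hqc : ∀ p q y : Ed d, H ((1/2 : ℝ) • (p + q)) y ≤ max (H p y) (H q y))
    (Λ : ℝ → ℝ → ℝ)
    (hΛcont : Continuous fun m : ℝ × ℝ => Λ m.1 m.2)
    (hΛmono : ∀ a b a' b' : ℝ, a ≤ a' → b ≤ b' → Λ a b ≤ Λ a' b')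
    (hΛstrict : ∀ a b : ℝ, a ≠ b → Λ a b < max a b)
    (hsqc : ∀ p q y : Ed d, H ((1/2 : ℝ) • (p + q)) y ≤ Λ (H p y) (H q y))
    (K : Set (Ed d)) (hKne : K.Nonempty) (hK : IsCompact K)
    (p : Ed d) (μ : ℝ) (hμ : Hhat d H p < μ)
    (u v : Ed d → ℝ)
    (hu : UpperSemicontinuous u) (hv : LowerSemicontinuous v)
    (husub : ViscSub d (fun q y => H (p + q) y) μ Kᶜ u)
    (hvsuper : ViscSuper d (fun q y => H (p + q) y) μ Kᶜ v)
    (hvgrowth : ∀ ε : ℝ, 0 < ε → ∃ R : ℝ, ∀ y : Ed d, R ≤ ‖y‖ → -ε ≤ v y / ‖y‖) :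
    ∃ x₀ ∈ K, ∀ y : Ed d, u y - v y ≤ u x₀ - v x₀ := by
  obtain ⟨w, hw, ⟨μ₁, hμ₁, hwμ⟩, ⟨Cw, hCw⟩, hwsub⟩ :=
    exists_smooth_strict H hHcont hreg_bdd hreg_uc hqc p μ hμ
  obtain ⟨R₁, hR₁⟩ := hcoer (μ + 1)
  obtain ⟨R₀, hR₀⟩ := hK.isBounded.exists_norm_le
  obtain ⟨Mu, hMu⟩ := sub_growth (fun q y => H (p + q) y) μ (|R₁| + ‖p‖ + 1) (|R₀| + 1)
    (by positivity) (by positivity) (by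
      intro q y hq
      have h1 : ‖q‖ ≤ ‖p + q‖ + ‖p‖ := by
        have := norm_sub_le (p + q) p
        simpa using this
      have := hR₁ (p + q) y (by have := le_abs_self R₁; linarith)
      linarith) K
    (fun x hx => (hR₀ x hx).trans (by have := le_abs_self R₀; linarith)) u hu husub
  -- growth of `v`
  have hvsc : UpperSemicontinuous (fun y => - v y) := by
    have hc : Continuous (fun t : ℝ => -t) := by fun_prop
    exact hc.comp_lowerSemicontinuous_antitone hv (fun a b hab => neg_le_neg hab)
  have hvlow : ∀ ε : ℝ, 0 < ε → ∃ C, ∀ y, - v y ≤ C + ε * ‖y‖ := by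
    intro ε hε
    obtain ⟨R, hR⟩ := hvgrowth ε hε
    obtain ⟨C, hC⟩ := usc_le_on hvsc (isCompact_closedBall (0 : Ed d) (|R| + 1))
    refine ⟨|C|, fun y => ?_⟩
    have h0 : 0 ≤ ε * ‖y‖ := by positivity
    rcases le_total ‖y‖ (|R| + 1) with h | h
    · have := hC y (by simpa using h)
      have := le_abs_self C
      linarith
    · have h1 := le_abs_self R
      have h2 := abs_nonneg R
      have h3 := hR y (by linarith)
      rw [le_div_iff₀ (by linarith)] at h3
      have := abs_nonneg C
      linarith
  -- a linear bound for `u - w`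
  set C₁ : ℝ := |Mu| + (|R₁| + ‖p‖ + 1) + |Cw| with hC₁
  have hC₁pos : 0 < C₁ := by positivity
  have huw : ∀ y, u y - w y ≤ C₁ * (1 + ‖y‖) := by
    intro y
    have h1 := hMu y
    have h2 := hCw y
    have h3 := norm_nonneg y
    have h4 := le_abs_self Mu
    have h5 : Cw * (1 + ‖y‖) ≤ |Cw| * (1 + ‖y‖) :=
      mul_le_mul_of_nonneg_right (le_abs_self _) (by linarith)
    have h6 : 0 ≤ |Mu| * ‖y‖ := by positivity
    have h7 : 0 ≤ |R₁| + ‖p‖ + 1 := by positivity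
    rw [hC₁]
    nlinarith
  -- maxima on `K`
  have hwv : UpperSemicontinuous (fun y => w y + (- v y)) :=
    hw.continuous.upperSemicontinuous.add hvsc
  have huv : UpperSemicontinuous (fun y => u y + (- v y)) := hu.add hvsc
  obtain ⟨M₁, hM₁⟩ := usc_le_on hwv hK
  obtain ⟨x₀, hx₀, hmax⟩ := (huv.upperSemicontinuousOn K).exists_isMaxOn hKne hK
  have hM₀ : ∀ y ∈ K, u y - v y ≤ u x₀ - v x₀ := fun y hy => by
    have := hmax hy
    simp only [Set.mem_ofPred_eq] at this
    linarith
  refine ⟨x₀, hx₀, ?_⟩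
  set M₀ := u x₀ - v x₀ with hM₀def
  have hKb : ∀ η : ℝ, 0 ≤ η → η ≤ 1 → ∀ y ∈ K,
      η * u y + (1 - η) * w y - v y ≤ η * M₀ + (1 - η) * M₁ := by
    intro η h0 h1 y hy
    have e1 := mul_le_mul_of_nonneg_left (hM₀ y hy) h0
    have e2 := mul_le_mul_of_nonneg_left (hM₁ y hy) (sub_nonneg.2 h1)
    nlinarith
  have main : ∀ k : ℕ, ∀ y, (1 - (1/2 : ℝ)^(k+1)) * u y + (1 - (1 - (1/2 : ℝ)^(k+1))) * w y - v y
      ≤ (1 - (1/2 : ℝ)^(k+1)) * M₀ + (1 - (1 - (1/2 : ℝ)^(k+1))) * M₁ := by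
    intro k
    obtain ⟨ν, hν, hstr⟩ := strict_level H hHcont hqc Λ hΛmono hΛstrict hsqc μ μ₁ hμ₁ (k+1)
    set θ : ℝ := 1 - (1/2 : ℝ)^(k+1) with hθ
    have hθ0 : 0 < θ := by
      have : (1/2 : ℝ)^(k+1) < 1 := pow_lt_one₀ (by norm_num) (by norm_num) (by simp)
      linarith
    have hθ1 : θ ≤ 1 := by
      have : (0:ℝ) < (1/2 : ℝ)^(k+1) := by positivity
      linarith
    obtain ⟨δ, hδ, huc⟩ := hreg_uc (|R₁| + 1) (by positivity) (μ - ν) (by linarith)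
    set b : ℝ := min 1 (δ/2) with hb
    have hb0 : 0 < b := lt_min one_pos (by linarith)
    have hb1 : b ≤ 1 := min_le_left _ _
    have hb2 : b ≤ δ/2 := min_le_right _ _
    have hcomp : ∀ Q Q' x y, H Q' x ≤ ν → ‖Q - Q'‖ ≤ b → ‖x - y‖ < δ → H Q y < μ := by
      intro Q Q' x y h1 h2 h3
      have hQ' : ‖Q'‖ ≤ |R₁| := by
        by_contra hc
        have := hR₁ Q' x ((le_abs_self _).trans (not_le.1 hc).le)
        linarith
      have hQ : ‖Q‖ ≤ |R₁| + 1 := by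
        have := norm_add_le (Q - Q') Q'
        simp only [sub_add_cancel] at this
        linarith
      have := huc Q Q' y x hQ (by linarith) (by linarith) (by rwa [norm_sub_rev])
      have := (abs_lt.1 this).2
      linarith
    let Gr : ℝ → Prop := fun t => ∀ ε : ℝ, 0 < ε → ∃ C, ∀ y,
      t * u y + (1 - t) * w y - v y ≤ C + ε * ‖y‖
    have stepP : ∀ l η : ℝ, l ≤ η → 0 < η → η ≤ θ → (η - l) * C₁ ≤ b / 4 → Gr l →
        ∀ y, η * u y + (1 - η) * w y - v y ≤ η * M₀ + (1 - η) * M₁ := by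
      intro l η h1 h2 h3 h4 h5
      obtain ⟨C, hC⟩ := h5 (b/4) (by linarith)
      refine penalized H p μ ν η b δ _ (C + b/4) (b/2) K hK u v w hu hv husub hvsuper hw hb0 h2
        ?_ hδ hcomp (by linarith) ?_ (hKb η h2.le (h3.trans hθ1))
      · intro q y hq
        exact hstr (p + q) (p + gradient w y) y hq (hwμ y) η h2.le h3
      · intro y
        have e1 := hC y
        have e2 := mul_le_mul_of_nonneg_left (huw y) (sub_nonneg.2 h1)
        have e3 : (η - l) * C₁ * (1 + ‖y‖) ≤ b / 4 * (1 + ‖y‖) :=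
          mul_le_mul_of_nonneg_right h4 (by positivity)
        nlinarith
    have PGr : ∀ η : ℝ, (∀ y, η * u y + (1 - η) * w y - v y ≤ η * M₀ + (1 - η) * M₁) → Gr η := by
      intro η h ε hε
      refine ⟨η * M₀ + (1 - η) * M₁, fun y => (h y).trans ?_⟩
      have : 0 ≤ ε * ‖y‖ := by positivity
      linarith
    have Gr0 : Gr 0 := by
      intro ε hε
      obtain ⟨A, hA⟩ := hwsub (ε/2) (by linarith)
      obtain ⟨A', hA'⟩ := hvlow (ε/2) (by linarith)
      refine ⟨A + A', fun y => ?_⟩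
      have := hA y
      have := hA' y
      linarith
    obtain ⟨N, hN⟩ := exists_nat_gt (C₁ / (b / 4))
    have hNpos : (0:ℝ) < N := lt_trans (by positivity) hN
    have hN' : C₁ / N ≤ b / 4 := by
      rw [div_lt_iff₀ (by linarith)] at hN
      rw [div_le_iff₀ hNpos]; linarith
    have hind : ∀ j : ℕ, j ≤ N → Gr (θ * j / N) := by
      intro j
      induction j with
      | zero => intro _; simpa using Gr0
      | succ j ih =>
        intro hj
        have hj' : ((j : ℝ) + 1) ≤ N := by exact_mod_cast hj
        have e : θ * ((j + 1 : ℕ) : ℝ) / N - θ * j / N = θ / N := by push_cast; ring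
        have e0 : 0 < θ / N := by positivity
        refine PGr _ (stepP (θ * j / N) _ (by linarith) (by positivity) ?_ ?_ (ih (by omega)))
        · rw [div_le_iff₀ hNpos]; push_cast
          exact mul_le_mul_of_nonneg_left hj' hθ0.le
        · rw [e]
          calc θ / N * C₁ = θ * (C₁ / N) := by ring
            _ ≤ 1 * (C₁ / N) := mul_le_mul_of_nonneg_right hθ1 (by positivity)
            _ ≤ b / 4 := by linarith
    have hfin : Gr θ := by
      have := hind N le_rfl
      rwa [mul_div_assoc, div_self hNpos.ne', mul_one] at this
    exact stepP θ θ le_rfl hθ0 le_rfl (by simp; linarith) hfin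
  intro y
  have hp : Tendsto (fun k : ℕ => 1 - (1/2 : ℝ)^(k+1)) atTop (𝓝 1) := by
    have := (tendsto_pow_atTop_nhds_zero_of_lt_one (by norm_num : (0:ℝ) ≤ 1/2)
      (by norm_num)).comp (tendsto_add_atTop_nat 1)
    simpa [Function.comp_def] using this.const_sub 1
  have ha : ∀ A B D : ℝ, Tendsto (fun k : ℕ => (1 - (1/2 : ℝ)^(k+1)) * A +
      (1 - (1 - (1/2 : ℝ)^(k+1))) * B - D) atTop (𝓝 (1 * A + (1 - 1) * B - D)) := fun A B D =>
    ((hp.mul_const A).add ((hp.const_sub 1).mul_const B)).sub_const D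
  have := le_of_tendsto_of_tendsto' (ha (u y) (w y) (v y)) (ha M₀ M₁ 0) (fun k => by
    have := main k y; linarith)
  linarith
end
end

section
/- For every μ > H̄* there is a constant C_μ > 0 such that for every x ∈ ℝ^d: (i) m_μ(x,x) = 0, m_μ(y,x) ≤ C_μ|y−x| for all y, and |m_μ(z,x) − m_μ(y,x)| ≤ C_μ|z−y| for all y, z (so m_μ(·,x) ∈ 𝓛); (ii) m_μ(·,x) is a viscosity subsolution of H(Du,y) ≤ μ in all of ℝ^d and a viscosity supersolution of H(Du,y) ≥ μ in ℝ^d ∖ {x}; (iii) m_μ(·,x) is maximal: if w ∈ 𝓛 satisfies H(Dw(z), z) ≤ μ for almost every z ∈ ℝ^d, then w(y) − w(x) ≤ m_μ(y,x) for all y; (iv) m_μ is subadditive: m_μ(z,x) ≤ m_μ(y,x) + m_μ(z,y) for all x, y, z ∈ ℝ^d. -/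
open MeasureTheory Filter Topology Bornology
open scoped RealInnerProductSpace NNReal

noncomputable section

/-- A closed midpoint-convex set is convex. -/
lemma convex_of_closed_midpoint {d : ℕ} (K : Set (Ed d)) (hK : IsClosed K)
    (hm : ∀ p ∈ K, ∀ q ∈ K, (1/2 : ℝ) • (p + q) ∈ K) : Convex ℝ K := by
  rw [convex_iff_segment_subset]
  intro p hp q hq z hz
  rw [segment_eq_image_lineMap] at hz
  obtain ⟨t, ⟨ht0, ht1⟩, rfl⟩ := hz
  by_contra hcon
  set g : ℝ → Ed d := fun s => AffineMap.lineMap p q s with hg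
  have hgc : Continuous g := by
    simp only [hg, AffineMap.lineMap_apply_module]
    fun_prop
  have hgm : ∀ a b, g ((a + b) / 2) = (1/2 : ℝ) • (g a + g b) := by
    intro a b
    simp only [hg, AffineMap.lineMap_apply_module]
    module
  have hS : IsClosed (g ⁻¹' K) := hK.preimage hgc
  have hA : IsCompact (g ⁻¹' K ∩ Set.Icc 0 t) := isCompact_Icc.inter_left hS
  have hB : IsCompact (g ⁻¹' K ∩ Set.Icc t 1) := isCompact_Icc.inter_left hS
  have hAn : (g ⁻¹' K ∩ Set.Icc 0 t).Nonempty := ⟨0, by simpa [hg] using hp, le_rfl, ht0⟩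
  have hBn : (g ⁻¹' K ∩ Set.Icc t 1).Nonempty := ⟨1, by simpa [hg] using hq, ht1, le_rfl⟩
  obtain ⟨a, ⟨haK, ha0, hat⟩, hamax⟩ := hA.exists_isGreatest hAn
  obtain ⟨b, ⟨hbK, hbt, hb1⟩, hbmin⟩ := hB.exists_isLeast hBn
  have hat' : a < t := lt_of_le_of_ne hat (by rintro rfl; exact hcon haK)
  have hbt' : t < b := lt_of_le_of_ne hbt (by rintro rfl; exact hcon hbK)
  have hmid : (a + b) / 2 ∈ g ⁻¹' K := by
    show g _ ∈ K
    rw [hgm]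
    exact hm _ haK _ hbK
  rcases le_total ((a + b) / 2) t with h | h
  · have := hamax ⟨hmid, by linarith, h⟩
    linarith
  · have := hbmin ⟨hmid, h, by linarith⟩
    linarith

/-- An a.e. property holds a.e. on almost every line in a given direction. -/
lemma ae_line {d : ℕ} (P : Ed d → Prop) (hP : ∀ᵐ z ∂(volume : Measure (Ed d)), P z) (e : Ed d) :
    ∀ᵐ x ∂(volume : Measure (Ed d)), ∀ᵐ s ∂(volume : Measure ℝ), P (x + s • e) := by
  obtain ⟨N, hN, hNm, hN0⟩ := exists_measurable_superset_of_null (ae_iff.1 hP)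
  have h1 : ∀ᵐ x ∂(volume : Measure (Ed d)), ∀ᵐ s ∂(volume : Measure ℝ), x + s • e ∉ N := by
    rw [Measure.ae_ae_comm]
    · refine ae_of_all _ fun s => ?_
      have h2 : ∀ᵐ z ∂(volume : Measure (Ed d)), z ∉ N := by
        rw [ae_iff]; simpa using hN0
      exact (measurePreserving_add_right volume (s • e)).quasiMeasurePreserving.ae h2
    · have : Measurable fun q : Ed d × ℝ => q.1 + q.2 • e := by fun_prop
      exact (this hNm).compl
  filter_upwards [h1] with x hx
  filter_upwards [hx] with s hs
  by_contra hc
  exact hs (hN hc)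

/-- Directional bound for the gradient a.e. gives a bound of the increments. -/
lemma incr_le {d : ℕ} {u : Ed d → ℝ} {K : ℝ≥0} (hu : LipschitzWith K u) {B : Set (Ed d)}
    (hBo : IsOpen B) (hBc : Convex ℝ B) (e : Ed d) (a : ℝ)
    (hae : ∀ᵐ z ∂(volume : Measure (Ed d)), z ∈ B → ⟪gradient u z, e⟫ ≤ a)
    (x : Ed d) (t : ℝ) (ht : 0 ≤ t) (hx : x ∈ B) (hxt : x + t • e ∈ B) :
    u (x + t • e) - u x ≤ a * t := by
  have huc := hu.continuous
  have hae2 : ∀ᵐ z ∂(volume : Measure (Ed d)), DifferentiableAt ℝ u z ∧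
      (z ∈ B → ⟪gradient u z, e⟫ ≤ a) := by
    filter_upwards [hu.ae_differentiableAt, hae] with z h1 h2 using ⟨h1, h2⟩
  have hkey : ∀ᵐ y ∂(volume : Measure (Ed d)), y ∈ B → y + t • e ∈ B →
      u (y + t • e) - u y ≤ a * t := by
    filter_upwards [ae_line _ hae2 e] with y hy hyB hytB
    have hlip : LipschitzWith (K * ‖e‖₊) (fun s : ℝ => u (y + s • e)) := by
      refine hu.comp ?_
      refine LipschitzWith.of_dist_le_mul fun s s' => ?_
      rw [dist_add_left, dist_eq_norm, ← sub_smul, norm_smul, dist_eq_norm, mul_comm]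
      rfl
    have hac := (hlip.lipschitzOnWith (s := Set.uIcc 0 t)).absolutelyContinuousOnInterval
    have hint := hac.integral_deriv_eq_sub
    have hle : ∫ s in (0:ℝ)..t, deriv (fun s : ℝ => u (y + s • e)) s ≤ ∫ s in (0:ℝ)..t, a := by
      refine intervalIntegral.integral_mono_ae_restrict ht hac.intervalIntegrable_deriv
        (by simp) ?_
      have hae0 : ∀ᵐ s ∂(volume : Measure ℝ), s ≠ 0 ∧ s ≠ t := by
        filter_upwards [Measure.ae_ne volume (0:ℝ), Measure.ae_ne volume t] with s h1 h2
          using ⟨h1, h2⟩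
      filter_upwards [ae_restrict_of_ae hy, ae_restrict_of_ae hae0,
        ae_restrict_mem measurableSet_Icc] with s hs hs0 hsI
      have hsm : s ∈ Set.Ioo 0 t :=
        ⟨lt_of_le_of_ne hsI.1 hs0.1.symm, lt_of_le_of_ne hsI.2 hs0.2⟩
      have hmem : y + s • e ∈ B := by
        have hseg := hBc.add_smul_sub_mem hyB hytB (t := s / t)
          ⟨div_nonneg hsm.1.le ht, div_le_one_of_le₀ hsm.2.le ht⟩
        have htne : t ≠ 0 := (hsm.1.trans hsm.2).ne'
        rwa [add_sub_cancel_left, smul_smul, div_mul_cancel₀ _ htne] at hseg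
      have hd : HasDerivAt (fun s : ℝ => u (y + s • e)) (fderiv ℝ u (y + s • e) e) s := by
        have h1 : HasDerivAt (fun s : ℝ => y + s • e) e s := by
          simpa using ((hasDerivAt_id s).smul_const e).const_add y
        exact hs.1.hasFDerivAt.comp_hasDerivAt s h1
      rw [hd.deriv, ← inner_gradient_left]
      exact hs.2 hmem
    rw [hint] at hle
    simpa [mul_comm] using hle
  by_contra hcon
  push Not at hcon
  set O : Set (Ed d) := {y | y ∈ B ∧ y + t • e ∈ B ∧ a * t < u (y + t • e) - u y} with hO
  have hOo : IsOpen O := by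
    refine hBo.inter ((hBo.preimage (f := fun y : Ed d => y + t • e) (by fun_prop)).inter ?_)
    have hc : Continuous fun y => u (y + t • e) - u y := by fun_prop
    exact isOpen_lt (f := fun _ => a * t) continuous_const hc
  have hO0 : volume O = 0 := by
    rw [ae_iff] at hkey
    refine measure_mono_null ?_ hkey
    rintro y ⟨h1, h2, h3⟩ h4
    exact absurd (h4 h1 h2) (not_le.2 h3)
  have := hOo.eq_empty_of_measure_zero hO0
  have hxO : x ∈ O := ⟨hx, hxt, hcon⟩
  rw [this] at hxO
  exact hxO

lemma norm_gradient_le_s7 {d : ℕ} {u : Ed d → ℝ} {K : ℝ≥0} (hu : LipschitzWith K u) (z : Ed d) :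
    ‖gradient u z‖ ≤ K := by
  rw [gradient, LinearIsometryEquiv.norm_map]
  exact norm_fderiv_le_of_lipschitz ℝ hu

/-- Admissible functions exist above the critical level. -/
lemma exists_adm {d : ℕ} {H : Ed d → Ed d → ℝ}
    (hreg_bdd : ∀ R : ℝ, 0 < R → ∃ M : ℝ, ∀ p y : Ed d, ‖p‖ ≤ R → |H p y| ≤ M)
    {μ : ℝ} (hμ : Hstar d H < μ) :
    ∃ w ∈ LipFuns d, ∀ᵐ z ∂(volume : Measure (Ed d)), H (gradient w z) z ≤ μ := by
  unfold Hstar at hμ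
  have hne : {t | ∃ w ∈ LipFuns d, t = essSup (fun y => H (gradient w y) y) volume}.Nonempty :=
    ⟨_, fun _ => 0, ⟨0, LipschitzWith.const 0⟩, rfl⟩
  obtain ⟨_, ⟨w, ⟨K, hw⟩, rfl⟩, hlt⟩ := exists_lt_of_csInf_lt hne hμ
  refine ⟨w, ⟨K, hw⟩, ?_⟩
  obtain ⟨M, hM⟩ := hreg_bdd (K + 1) (by positivity)
  have hb : IsBoundedUnder (· ≤ ·) (ae volume) (fun y => H (gradient w y) y) := by
    refine ⟨M, ?_⟩
    rw [eventually_map]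
    refine Eventually.of_forall fun y => ?_
    exact (le_abs_self _).trans (hM _ _ ((norm_gradient_le_s7 hw y).trans (by linarith)))
  filter_upwards [ae_le_essSup (f := fun y => H (gradient w y) y) (μ := volume) hb] with z hz
  exact hz.trans hlt.le

/-- Uniform Lipschitz bound for admissible functions. -/
lemma adm_lip {d : ℕ} {w : Ed d → ℝ} (hw : w ∈ LipFuns d) {C : ℝ}
    (h : ∀ᵐ z ∂(volume : Measure (Ed d)), ‖gradient w z‖ ≤ C) (x y : Ed d) :
    w y - w x ≤ C * ‖y - x‖ := by
  obtain ⟨K, hK⟩ := hw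
  have := incr_le hK isOpen_univ convex_univ (y - x) (C * ‖y - x‖) (by
    filter_upwards [h] with z hz _
    exact (real_inner_le_norm _ _).trans (by gcongr)) x 1 zero_le_one trivial trivial
  simpa using this

/-- The separation argument: uniform directional estimate. -/
lemma sep {d : ℕ} {H : Ed d → Ed d → ℝ} (hHcont : Continuous fun q : Ed d × Ed d => H q.1 q.2)
    (hreg_uc : ∀ R : ℝ, 0 < R → ∀ ε : ℝ, 0 < ε → ∃ δ : ℝ, 0 < δ ∧ ∀ p p' y y' : Ed d,
      ‖p‖ ≤ R → ‖p'‖ ≤ R → ‖p - p'‖ < δ → ‖y - y'‖ < δ → |H p y - H p' y'| < ε)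
    (hqc : ∀ p q y : Ed d, H ((1/2 : ℝ) • (p + q)) y ≤ max (H p y) (H q y))
    {μ C : ℝ} (hC : 0 < C) (hcoer : ∀ p y : Ed d, H p y ≤ μ → ‖p‖ ≤ C)
    (p x₀ : Ed d) (hp : μ < H p x₀) :
    ∃ (e : Ed d) (a : ℝ), a < ⟪p, e⟫ ∧ ∃ τ > 0, ∀ t, 0 < t → t < τ → ∀ w ∈ LipFuns d,
      (∀ᵐ z ∂(volume : Measure (Ed d)), H (gradient w z) z ≤ μ) →
      w x₀ - w (x₀ - t • e) ≤ a * t := by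
  obtain ⟨η, hη1, hη2⟩ := exists_between hp
  have hcl : IsClosed {q : Ed d | H q x₀ ≤ η} :=
    isClosed_le (hHcont.comp (by fun_prop : Continuous fun q : Ed d => (q, x₀))) continuous_const
  have hconv : Convex ℝ {q : Ed d | H q x₀ ≤ η} :=
    convex_of_closed_midpoint _ hcl fun q hq q' hq' => (hqc q q' x₀).trans (max_le hq hq')
  obtain ⟨f, a, hf1, hf2⟩ := geometric_hahn_banach_closed_point hconv hcl
    (x := p) (by simpa using hη2)
  obtain ⟨δ, hδ, hδ'⟩ := hreg_uc C hC (η - μ) (by linarith)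
  set e : Ed d := (InnerProductSpace.toDual ℝ (Ed d)).symm f with he
  have hfe : ∀ q, ⟪q, e⟫ = f q := by
    intro q
    rw [real_inner_comm, he, InnerProductSpace.toDual_symm_apply]
  refine ⟨e, a, by rw [hfe]; exact hf2, δ / (‖e‖ + 1), by positivity, ?_⟩
  rintro t ht htτ w ⟨K, hK⟩ hw
  have hsm : t * ‖e‖ < δ := by
    rw [lt_div_iff₀ (by positivity)] at htτ
    nlinarith
  have := incr_le hK (Metric.isOpen_ball (x := x₀) (ε := δ)) (convex_ball x₀ δ) e a (by
    filter_upwards [hw] with z hz hzB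
    rw [hfe]
    refine (hf1 _ ?_).le
    have hb := hcoer _ _ hz
    have := hδ' (gradient w z) (gradient w z) z x₀ hb hb (by simpa using hδ)
      (by simpa [dist_eq_norm] using hzB)
    have := (abs_lt.1 this).1
    show H _ _ ≤ η
    linarith) (x₀ - t • e) t ht.le (by
      simp [dist_eq_norm, norm_smul, abs_of_pos ht, hsm]) (by simpa using hδ)
  simpa using this

/-- Sub-tangent comparison. -/
lemma sub_touch {d : ℕ} {u φ : Ed d → ℝ} {x₀ e : Ed d} {a τ : ℝ} (hτ : 0 < τ)
    (hφ : DifferentiableAt ℝ φ x₀) (ha : a < ⟪gradient φ x₀, e⟫)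
    (hu : ∀ t, 0 < t → t < τ → u x₀ - u (x₀ - t • e) ≤ a * t)
    (hmax : IsLocalMax (fun y => u y - φ y) x₀) : False := by
  have h1 : HasDerivAt (fun s : ℝ => x₀ - s • e) (-e) 0 := by
    simpa using ((hasDerivAt_id (0:ℝ)).smul_const e).const_sub x₀
  have h2 : HasDerivAt (fun s : ℝ => φ (x₀ - s • e)) (-⟪gradient φ x₀, e⟫) 0 := by
    have := (HasFDerivAt.comp_hasDerivAt (f := fun s : ℝ => x₀ - s • e) (x := (0:ℝ)) (f' := -e)
      (l := φ) (l' := fderiv ℝ φ x₀) (by simpa using hφ.hasFDerivAt) h1)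
    rw [map_neg, ← inner_gradient_left] at this
    exact this
  have h3 := (hasDerivAt_iff_tendsto_slope_zero.1 h2)
  have h4 : ∀ᶠ t in 𝓝[≠] (0:ℝ), t⁻¹ • (φ (x₀ - (0 + t) • e) - φ (x₀ - (0:ℝ) • e)) < -a :=
    h3.eventually_lt_const (by linarith)
  have h5 : ∀ᶠ t in 𝓝[>] (0:ℝ), t⁻¹ • (φ (x₀ - (0 + t) • e) - φ (x₀ - (0:ℝ) • e)) < -a :=
    h4.filter_mono (nhdsWithin_mono _ fun t (ht : 0 < t) => ht.ne')
  have h6 : ∀ᶠ t in 𝓝[>] (0:ℝ), u (x₀ - t • e) - φ (x₀ - t • e) ≤ u x₀ - φ x₀ := by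
    have hc : Tendsto (fun t : ℝ => x₀ - t • e) (𝓝[>] 0) (𝓝 x₀) := by
      have : ContinuousAt (fun t : ℝ => x₀ - t • e) 0 := by fun_prop
      have := this.tendsto.mono_left (nhdsWithin_le_nhds (s := Set.Ioi 0))
      simpa using this
    exact hc.eventually hmax
  have h7 : ∀ᶠ t in 𝓝[>] (0:ℝ), t ∈ Set.Ioo 0 τ := Ioo_mem_nhdsGT hτ
  obtain ⟨t, ht5, ht6, ht0, htτ⟩ := (h5.and (h6.and h7)).exists
  have hu' := hu t ht0 htτ
  simp only [zero_add, zero_smul, sub_zero, smul_eq_mul] at ht5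
  rw [inv_mul_lt_iff₀ ht0] at ht5
  nlinarith

/-- The perturbation argument: bump up a strict sub-tangent. -/
lemma bump {d : ℕ} {H : Ed d → Ed d → ℝ} (hHcont : Continuous fun q : Ed d × Ed d => H q.1 q.2)
    {μ : ℝ} {m φ : Ed d → ℝ} {C : ℝ≥0} (hm : LipschitzWith C m)
    (hmae : ∀ᵐ z ∂(volume : Measure (Ed d)), H (gradient m z) z ≤ μ)
    {x x₀ : Ed d} (hx : x₀ ≠ x) (hφ : DifferentiableAt ℝ φ x₀)
    (hmin : IsLocalMin (fun y => m y - φ y) x₀) (hlt : H (gradient φ x₀) x₀ < μ) :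
    ∃ w ∈ LipFuns d, (∀ᵐ z ∂(volume : Measure (Ed d)), H (gradient w z) z ≤ μ) ∧
      w x = m x ∧ m x₀ < w x₀ := by
  set p := gradient φ x₀ with hp
  -- continuity of `H`
  have hev : ∀ᶠ q in 𝓝 (p, x₀), H q.1 q.2 < μ :=
    hHcont.continuousAt.eventually_lt_const hlt
  obtain ⟨ρ, hρ, hρH⟩ := Metric.eventually_nhds_iff.1 hev
  set κ : ℝ := ρ / 2 with hκ
  have hκ0 : 0 < κ := by positivity
  -- differentiability of φ
  have hφ1 : ∀ᶠ y in 𝓝 x₀, |φ y - φ x₀ - ⟪p, y - x₀⟫| ≤ κ / 2 * ‖y - x₀‖ := by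
    have := hφ.hasFDerivAt.isLittleO.def (c := κ / 2) (by positivity)
    filter_upwards [this] with y hy
    rw [hp, inner_gradient_left]
    simpa using hy
  have hm1 : ∀ᶠ y in 𝓝 x₀, m x₀ + ⟪p, y - x₀⟫ - κ / 2 * ‖y - x₀‖ ≤ m y := by
    filter_upwards [hφ1, hmin] with y h1 h2
    have := (abs_le.1 h1).1
    linarith
  obtain ⟨r₁, hr₁, hm2⟩ := Metric.eventually_nhds_iff.1 hm1
  have hxx : 0 < ‖x - x₀‖ := norm_pos_iff.2 (sub_ne_zero.2 hx.symm)
  obtain ⟨r, hr, hr1, hr2, hr3⟩ : ∃ r : ℝ, 0 < r ∧ r < r₁ ∧ r < ρ ∧ r ≤ ‖x - x₀‖ := by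
    refine ⟨min (min (r₁ / 2) (ρ / 2)) ‖x - x₀‖, by positivity, ?_, ?_, min_le_right _ _⟩
    · exact ((min_le_left _ _).trans (min_le_left _ _)).trans_lt (by linarith)
    · exact ((min_le_left _ _).trans (min_le_right _ _)).trans_lt (by linarith)
  set L : ℝ := 2 * (C + ‖p‖) with hL
  have hL0 : 0 ≤ L := by positivity
  set δ : ℝ := κ * r / 8 with hδ
  have hδ0 : 0 < δ := by positivity
  set ψ : Ed d → ℝ := fun y =>
    m x₀ + ⟪p, y - x₀⟫ + δ - κ * ‖y - x₀‖ - L * max (‖y - x₀‖ - r / 2) 0 with hψ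
  have hψlip : ∃ K : ℝ≥0, LipschitzWith K ψ := by
    refine ⟨(‖p‖ + κ + L).toNNReal, LipschitzWith.of_le_add_mul _ fun y z => ?_⟩
    rw [Real.coe_toNNReal _ (by positivity), dist_eq_norm]
    have h1 : ⟪p, y - x₀⟫ - ⟪p, z - x₀⟫ ≤ ‖p‖ * ‖y - z‖ := by
      rw [← inner_sub_right, sub_sub_sub_cancel_right]
      exact real_inner_le_norm _ _
    have h2 : ‖z - x₀‖ ≤ ‖y - x₀‖ + ‖y - z‖ := by
      have := norm_sub_le (y - x₀) (y - z)
      rwa [sub_sub_sub_cancel_left] at this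
    have h3 : max (‖z - x₀‖ - r / 2) 0 ≤ max (‖y - x₀‖ - r / 2) 0 + ‖y - z‖ := by
      refine max_le ?_ ?_
      · have := le_max_left (‖y - x₀‖ - r / 2) 0
        linarith
      · have := le_max_right (‖y - x₀‖ - r / 2) 0
        positivity
    have h4 := mul_le_mul_of_nonneg_left h2 hκ0.le
    have h5 := mul_le_mul_of_nonneg_left h3 hL0
    simp only [hψ]
    linarith
  have hψm : ∀ y, r / 2 ≤ ‖y - x₀‖ → ψ y < m y := by
    intro y hy
    have hδy : δ < κ / 2 * ‖y - x₀‖ := by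
      rw [hδ]; nlinarith
    rcases lt_or_ge ‖y - x₀‖ r₁ with h | h
    · have h1 := hm2 (y := y) (by rwa [dist_eq_norm])
      have h2 : 0 ≤ L * max (‖y - x₀‖ - r / 2) 0 := by positivity
      simp only [hψ]
      linarith
    · have h1 : m x₀ - m y ≤ C * ‖y - x₀‖ := by
        have := hm.dist_le_mul x₀ y
        rw [Real.dist_eq, dist_comm, dist_eq_norm] at this
        exact (le_abs_self _).trans this
      have h2 : ‖y - x₀‖ / 2 ≤ max (‖y - x₀‖ - r / 2) 0 :=
        le_trans (by linarith) (le_max_left _ _)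
      have h3 := mul_le_mul_of_nonneg_left h2 hL0
      have h4 := real_inner_le_norm p (y - x₀)
      have h5 : 0 < κ / 2 * ‖y - x₀‖ := by linarith
      have h6 : L * (‖y - x₀‖ / 2) = C * ‖y - x₀‖ + ‖p‖ * ‖y - x₀‖ := by rw [hL]; ring
      simp only [hψ]
      linarith
  obtain ⟨K, hK⟩ := hψlip
  set w : Ed d → ℝ := fun y => max (m y) (ψ y) with hw
  have hwlip : LipschitzWith (max C K) w := hm.max hK
  refine ⟨w, ⟨_, hwlip⟩, ?_, ?_, ?_⟩
  · filter_upwards [hmae, hm.ae_differentiableAt, hwlip.ae_differentiableAt] with y h1 h2 h3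
    rcases lt_or_ge (m y) (ψ y) with h | h
    · -- here `w = ψ` near `y`
      have hyr : ‖y - x₀‖ < r / 2 := by
        by_contra hc
        exact absurd (hψm y (not_lt.1 hc)) (not_lt.2 h.le)
      have hev1 : ∀ᶠ z in 𝓝 y, m z < ψ z :=
        hm.continuous.continuousAt.eventually_lt hK.continuous.continuousAt h
      have hev2 : ∀ᶠ z in 𝓝 y, ‖z - x₀‖ < r / 2 := by
        have : ContinuousAt (fun z : Ed d => ‖z - x₀‖) y := by fun_prop
        exact this.eventually_lt_const hyr
      have hev3 : ∀ᶠ z in 𝓝 y, w z = m x₀ + ⟪p, z - x₀⟫ + δ - κ * ‖z - x₀‖ := by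
        filter_upwards [hev1, hev2] with z hz1 hz2
        have hz3 : w z = ψ z := max_eq_right hz1.le
        rw [hz3]
        simp only [hψ]
        rw [max_eq_right (by linarith : ‖z - x₀‖ - r / 2 ≤ 0)]
        ring
      have hn : ‖fderiv ℝ w y - innerSL ℝ p‖ ≤ κ := by
        have hd : HasFDerivAt (fun z => w z - innerSL ℝ p z) (fderiv ℝ w y - innerSL ℝ p) y :=
          h3.hasFDerivAt.sub (innerSL ℝ p).hasFDerivAt
        refine hd.le_of_lip' hκ0.le ?_
        filter_upwards [hev3] with z hz
        rw [hz, hev3.self_of_nhds]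
        simp only [innerSL_apply_apply, inner_sub_right]
        have e1 : m x₀ + (⟪p, z⟫ - ⟪p, x₀⟫) + δ - κ * ‖z - x₀‖ - ⟪p, z⟫ -
          (m x₀ + (⟪p, y⟫ - ⟪p, x₀⟫) + δ - κ * ‖y - x₀‖ - ⟪p, y⟫) =
          κ * (‖y - x₀‖ - ‖z - x₀‖) := by ring
        rw [e1, norm_mul, Real.norm_of_nonneg hκ0.le, Real.norm_eq_abs]
        gcongr
        have := abs_norm_sub_norm_le (y - x₀) (z - x₀)
        rwa [sub_sub_sub_cancel_right, norm_sub_rev y z] at this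
      have hg : ‖gradient w y - p‖ ≤ κ := by
        have e2 : gradient w y - p =
            (InnerProductSpace.toDual ℝ (Ed d)).symm (fderiv ℝ w y - innerSL ℝ p) := by
          rw [map_sub, gradient]
          congr 1
          rw [LinearIsometryEquiv.eq_symm_apply]
          rfl
        rw [e2, LinearIsometryEquiv.norm_map]
        exact hn
      refine (hρH (y := (gradient w y, y)) ?_).le
      rw [Prod.dist_eq, max_lt_iff, dist_eq_norm, dist_eq_norm]
      exact ⟨hg.trans_lt (by rw [hκ]; linarith), hyr.trans (by linarith)⟩
    · -- `w` touches `m` from above at `y`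
      have hmn : IsLocalMin (fun z => w z - m z) y := by
        refine Eventually.of_forall fun z => ?_
        simp only [hw, max_eq_left h, sub_self]
        exact sub_nonneg.2 (le_max_left _ _)
      have h0 := hmn.fderiv_eq_zero
      rw [fderiv_fun_sub h3 h2, sub_eq_zero] at h0
      have : gradient w y = gradient m y := by rw [gradient, gradient, h0]
      rw [this]
      exact h1
  · exact max_eq_left (hψm x (by linarith)).le
  · have : ψ x₀ = m x₀ + δ := by
      simp only [hψ, sub_self, inner_zero_right, norm_zero, zero_sub]
      rw [max_eq_right (by linarith)]
      ring
    simp only [hw, this]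
    exact lt_max_of_lt_right (by linarith)

/-- properties of the maximal subsolutions m_μ of the metric problem. -/
theorem statement_7
    (d : ℕ) (hd : 0 < d)
    (H : Ed d → Ed d → ℝ)
    (hHcont : Continuous fun q : Ed d × Ed d => H q.1 q.2)
    (hreg_bdd : ∀ R : ℝ, 0 < R → ∃ M : ℝ, ∀ p y : Ed d, ‖p‖ ≤ R → |H p y| ≤ M)
    (hreg_uc : ∀ R : ℝ, 0 < R → ∀ ε : ℝ, 0 < ε → ∃ δ : ℝ, 0 < δ ∧ ∀ p p' y y' : Ed d,
      ‖p‖ ≤ R → ‖p'‖ ≤ R → ‖p - p'‖ < δ → ‖y - y'‖ < δ → |H p y - H p' y'| < ε)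
    (hcoer : ∀ M : ℝ, ∃ R : ℝ, ∀ p y : Ed d, R ≤ ‖p‖ → M ≤ H p y)
    (hqc : ∀ p q y : Ed d, H ((1/2 : ℝ) • (p + q)) y ≤ max (H p y) (H q y))
    (Λ : ℝ → ℝ → ℝ)
    (hΛcont : Continuous fun m : ℝ × ℝ => Λ m.1 m.2)
    (hΛmono : ∀ a b a' b' : ℝ, a ≤ a' → b ≤ b' → Λ a b ≤ Λ a' b')
    (hΛstrict : ∀ a b : ℝ, a ≠ b → Λ a b < max a b)
    (hsqc : ∀ p q y : Ed d, H ((1/2 : ℝ) • (p + q)) y ≤ Λ (H p y) (H q y))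
    :
    ∀ μ : ℝ, Hstar d H < μ → ∃ C : ℝ, 0 < C ∧ ∀ x : Ed d,
      (mMu d H μ x x = 0 ∧ (∀ y : Ed d, mMu d H μ y x ≤ C * ‖y - x‖) ∧
        (∀ y z : Ed d, |mMu d H μ z x - mMu d H μ y x| ≤ C * ‖z - y‖) ∧
        (fun y => mMu d H μ y x) ∈ LipFuns d) ∧
      (ViscSub d H μ Set.univ (fun y => mMu d H μ y x) ∧
        ViscSuper d H μ ({x}ᶜ) (fun y => mMu d H μ y x)) ∧
      (∀ w ∈ LipFuns d, (∀ᵐ z ∂volume, H (gradient w z) z ≤ μ) →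
        ∀ y : Ed d, w y - w x ≤ mMu d H μ y x) ∧
      (∀ y z : Ed d, mMu d H μ z x ≤ mMu d H μ y x + mMu d H μ z y) := by
  intro μ hμ
  obtain ⟨R, hR⟩ := hcoer (μ + 1)
  set C : ℝ := max R 1 with hCdef
  have hC : 0 < C := lt_of_lt_of_le one_pos (le_max_right _ _)
  have hco : ∀ p y : Ed d, H p y ≤ μ → ‖p‖ ≤ C := by
    intro p y h
    by_contra hc
    have := hR p y ((le_max_left _ _).trans (not_le.1 hc).le)
    linarith
  obtain ⟨w₀, hw₀, hw₀'⟩ := exists_adm hreg_bdd hμ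
  have hlip : ∀ w ∈ LipFuns d, (∀ᵐ z ∂(volume : Measure (Ed d)), H (gradient w z) z ≤ μ) →
      ∀ x y, w y - w x ≤ C * ‖y - x‖ := by
    intro w hw h x y
    refine adm_lip hw ?_ x y
    filter_upwards [h] with z hz using hco _ _ hz
  have hle : ∀ w ∈ LipFuns d, (∀ᵐ z ∂(volume : Measure (Ed d)), H (gradient w z) z ≤ μ) →
      ∀ x y : Ed d, w y - w x ≤ mMu d H μ y x := by
    intro w hw h x y
    refine le_csSup ⟨C * ‖y - x‖, ?_⟩ ⟨w, hw, h, rfl⟩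
    rintro _ ⟨v, hv, hv', rfl⟩
    exact hlip v hv hv' x y
  have hsup : ∀ (x y : Ed d) (b : ℝ), (∀ w ∈ LipFuns d,
      (∀ᵐ z ∂(volume : Measure (Ed d)), H (gradient w z) z ≤ μ) → w y - w x ≤ b) →
      mMu d H μ y x ≤ b := by
    intro x y b h
    refine csSup_le ⟨_, w₀, hw₀, hw₀', rfl⟩ ?_
    rintro _ ⟨v, hv, hv', rfl⟩
    exact h v hv hv'
  have hbd : ∀ x y : Ed d, mMu d H μ y x ≤ C * ‖y - x‖ := fun x y =>
    hsup x y _ fun w hw h => hlip w hw h x y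
  have hsub : ∀ x y z : Ed d, mMu d H μ z x ≤ mMu d H μ y x + mMu d H μ z y := by
    intro x y z
    refine hsup x z _ fun w hw h => ?_
    have h1 := hle w hw h x y
    have h2 := hle w hw h y z
    linarith
  have habs : ∀ x y z : Ed d, |mMu d H μ z x - mMu d H μ y x| ≤ C * ‖z - y‖ := by
    intro x y z
    have h1 := hsub x y z
    have h2 := hsub x z y
    have h3 := hbd y z
    have h4 := hbd z y
    rw [norm_sub_rev] at h4
    exact abs_le.2 ⟨by linarith, by linarith⟩
  have hmL : ∀ x, LipschitzWith C.toNNReal (fun y => mMu d H μ y x) := by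
    intro x
    refine LipschitzWith.of_dist_le_mul fun z y => ?_
    rw [Real.coe_toNNReal _ hC.le, Real.dist_eq, dist_eq_norm]
    exact habs x y z
  -- subsolution property
  have hvs : ∀ (x : Ed d) (φ : Ed d → ℝ) (x₀ : Ed d), DifferentiableAt ℝ φ x₀ →
      IsLocalMax (fun y => mMu d H μ y x - φ y) x₀ → H (gradient φ x₀) x₀ ≤ μ := by
    intro x φ x₀ hφ hmax
    by_contra hcon
    obtain ⟨e, a, ha, τ, hτ, he⟩ :=
      sep hHcont hreg_uc hqc hC hco (gradient φ x₀) x₀ (not_le.1 hcon)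
    refine sub_touch (u := fun y => mMu d H μ y x) hτ hφ ha (fun t ht ht' => ?_) hmax
    have : mMu d H μ x₀ x ≤ mMu d H μ (x₀ - t • e) x + a * t := by
      refine hsup _ _ _ fun w hw h => ?_
      have h1 := he t ht ht' w hw h
      have h2 := hle w hw h x (x₀ - t • e)
      linarith
    linarith
  have hmae : ∀ x, ∀ᵐ z ∂(volume : Measure (Ed d)),
      H (gradient (fun y => mMu d H μ y x) z) z ≤ μ := by
    intro x
    filter_upwards [(hmL x).ae_differentiableAt] with z hz
    refine hvs x _ z hz ?_
    refine Eventually.of_forall fun y => ?_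
    simp
  refine ⟨C, hC, fun x => ⟨⟨?_, hbd x, habs x, ⟨_, hmL x⟩⟩, ⟨?_, ?_⟩,
    fun w hw h y => hle w hw h x y, hsub x⟩⟩
  · refine le_antisymm (by simpa using hbd x x) ?_
    simpa using hle w₀ hw₀ hw₀' x x
  · intro φ x₀ _ hφ hmax
    rw [isLocalMaxOn_univ_iff] at hmax
    exact hvs x φ x₀ (hφ.differentiableAt one_ne_zero) hmax
  · intro φ x₀ hx₀ hφ hmin
    by_contra hcon
    have hmin' : IsLocalMin (fun y => mMu d H μ y x - φ y) x₀ :=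
      hmin.isLocalMin (isOpen_compl_singleton.mem_nhds hx₀)
    obtain ⟨w, hw, hw', h1, h2⟩ := bump hHcont (hmL x) (hmae x) (x := x)
      (by simpa using hx₀) (hφ.differentiableAt one_ne_zero) hmin' (not_le.1 hcon)
    have h3 := hle w hw hw' x x₀
    have h4 : mMu d H μ x x ≤ 0 := by simpa using hbd x x
    linarith
end
end

section
/- Let p, x ∈ ℝ^d and μ > Ĥ(p). Then the function v(y) := m_μ(y,x) − p·(y−x) is the unique function in SL⁺ which vanishes at x and is a viscosity solution of H(p+Dv,y) = μ in ℝ^d ∖ {x} (i.e., a viscosity subsolution of H(p+Dv,y) ≤ μ and a viscosity supersolution of H(p+Dv,y) ≥ μ in ℝ^d ∖ {x}). -/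
open MeasureTheory Filter Topology Bornology
open scoped RealInnerProductSpace NNReal

noncomputable section

/-! ### Auxiliary material -/

/-- The structural assumptions on the Hamiltonian used in the proof. -/
structure GoodH (d : ℕ) (F : Ed d → Ed d → ℝ) : Prop where
  cont : Continuous fun q : Ed d × Ed d => F q.1 q.2
  bdd : ∀ R : ℝ, 0 < R → ∃ M : ℝ, ∀ p y : Ed d, ‖p‖ ≤ R → |F p y| ≤ M
  uc : ∀ R : ℝ, 0 < R → ∀ ε : ℝ, 0 < ε → ∃ δ : ℝ, 0 < δ ∧ ∀ p p' y y' : Ed d,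
      ‖p‖ ≤ R → ‖p'‖ ≤ R → ‖p - p'‖ < δ → ‖y - y'‖ < δ → |F p y - F p' y'| < ε
  coer : ∀ M : ℝ, ∃ R : ℝ, ∀ p y : Ed d, R ≤ ‖p‖ → M ≤ F p y
  qc : ∀ p q y : Ed d, F ((1/2 : ℝ) • (p + q)) y ≤ max (F p y) (F q y)
  strict : ∀ μ μ₁ : ℝ, μ₁ < μ → ∃ μ₂, μ₂ < μ ∧ ∀ q q' y : Ed d, F q y ≤ μ → F q' y ≤ μ₁ →
      F ((1/2 : ℝ) • (q + q')) y ≤ μ₂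

/-- Almost everywhere Lipschitz subsolutions. -/
def SubAE (d : ℕ) (F : Ed d → Ed d → ℝ) (μ : ℝ) (w : Ed d → ℝ) : Prop :=
  w ∈ LipFuns d ∧ ∀ᵐ z ∂(volume : Measure (Ed d)), F (gradient w z) z ≤ μ

/-- A directional form of the subsolution property. -/
def DirProp (d : ℕ) (F : Ed d → Ed d → ℝ) (μ : ℝ) (f : Ed d → ℝ) : Prop :=
  ∀ (y e : Ed d) (c r : ℝ), (∀ z ∈ Metric.ball y r, ∀ q, F q z ≤ μ → ⟪q, e⟫ ≤ c) →
    ∀ t : ℝ, 0 ≤ t → t * ‖e‖ < r → f y - f (y - t • e) ≤ c * t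

lemma ae_line_good {d : ℕ} (e : Ed d) (P : Ed d → Prop) (h : ∀ᵐ z ∂(volume : Measure (Ed d)), P z) :
    ∀ᵐ z ∂(volume : Measure (Ed d)), ∀ᵐ s ∂(volume : Measure ℝ), P (z - s • e) := by
  obtain ⟨S, hS, hSm, hS0⟩ := exists_measurable_superset_of_null (ae_iff.1 h)
  have key : ∀ᵐ z ∂(volume : Measure (Ed d)), ∀ᵐ s ∂(volume : Measure ℝ), z - s • e ∉ S := by
    rw [Measure.ae_ae_comm]
    · refine Eventually.of_forall fun s => ?_
      have h1 : ∀ᵐ z ∂(volume : Measure (Ed d)), z ∉ S := by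
        rw [ae_iff]; simpa using hS0
      have := (measurePreserving_sub_right (volume : Measure (Ed d)) (s • e)).quasiMeasurePreserving.ae h1
      exact this
    · have hm : Measurable fun x : Ed d × ℝ => x.1 - x.2 • e := by fun_prop
      exact hm hSm.compl
  filter_upwards [key] with z hz
  filter_upwards [hz] with s hs
  by_contra hc
  exact hs (hS hc)

lemma dir_bound {d : ℕ} {w : Ed d → ℝ} {C : ℝ≥0} (hw : LipschitzWith C w) (y0 e : Ed d) (c r : ℝ)
    (h : ∀ᵐ z ∂(volume : Measure (Ed d)), z ∈ Metric.ball y0 r → ⟪gradient w z, e⟫ ≤ c)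
    (t : ℝ) (ht : 0 ≤ t) (htr : t * ‖e‖ < r) : w y0 - w (y0 - t • e) ≤ c * t := by
  have hd : ∀ᵐ z ∂(volume : Measure (Ed d)), DifferentiableAt ℝ w z := hw.ae_differentiableAt
  have hgood := ae_line_good e _ (h.and hd)
  have hwc : Continuous w := hw.continuous
  by_contra hcon
  push Not at hcon
  have hop : IsOpen {z : Ed d | c * t < w z - w (z - t • e)} :=
    isOpen_lt continuous_const (by fun_prop)
  have hη : 0 < r - t * ‖e‖ := by linarith
  have hop2 : IsOpen ({z : Ed d | c * t < w z - w (z - t • e)} ∩ Metric.ball y0 (r - t * ‖e‖)) :=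
    hop.inter Metric.isOpen_ball
  have hpos := hop2.measure_pos (volume : Measure (Ed d)) ⟨y0, hcon, Metric.mem_ball_self hη⟩
  obtain ⟨z, ⟨hz1, hz2⟩, hz3⟩ : ∃ z, z ∈ ({z : Ed d | c * t < w z - w (z - t • e)} ∩
      Metric.ball y0 (r - t * ‖e‖)) ∧ (∀ᵐ s ∂(volume : Measure ℝ), (z - s • e ∈ Metric.ball y0 r →
        ⟪gradient w (z - s • e), e⟫ ≤ c) ∧ DifferentiableAt ℝ w (z - s • e)) := by
    by_contra hno
    apply hpos.ne'
    refine measure_mono_null ?_ (ae_iff.1 hgood)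
    intro z hz
    exact fun hh => hno ⟨z, hz, hh⟩
  have hlip : LipschitzWith (C * ‖e‖₊) (fun s : ℝ => w (z - s • e)) := by
    refine hw.comp ?_
    refine LipschitzWith.of_dist_le_mul fun a b => ?_
    rw [dist_eq_norm, dist_eq_norm]
    have : z - a • e - (z - b • e) = (b - a) • e := by module
    rw [this, norm_smul, norm_sub_rev, mul_comm]; rfl
  have hac : AbsolutelyContinuousOnInterval (fun s : ℝ => w (z - s • e)) 0 t :=
    (hlip.lipschitzOnWith (s := Set.uIcc 0 t)).absolutelyContinuousOnInterval
  have hint := hac.integral_deriv_eq_sub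
  have hmono : ∫ s in (0:ℝ)..t, (-c) ≤ ∫ s in (0:ℝ)..t, deriv (fun s : ℝ => w (z - s • e)) s := by
    refine intervalIntegral.integral_mono_ae_restrict ht (by simp) hac.intervalIntegrable_deriv ?_
    rw [EventuallyLE, ae_restrict_iff' measurableSet_Icc]
    filter_upwards [hz3] with s hs hsI
    have hball : z - s • e ∈ Metric.ball y0 r := by
      rw [Metric.mem_ball, dist_eq_norm] at hz2 ⊢
      have h1 : z - s • e - y0 = (z - y0) - s • e := by module
      have h2 : ‖s • e‖ ≤ t * ‖e‖ := by
        rw [norm_smul, Real.norm_eq_abs, abs_of_nonneg hsI.1]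
        exact mul_le_mul_of_nonneg_right hsI.2 (norm_nonneg _)
      rw [h1]
      have := norm_sub_le (z - y0) (s • e)
      linarith
    have h3 := hs.1 hball
    have h4 : HasDerivAt (fun s : ℝ => z - s • e) (-e) s := by
      simpa using (((hasDerivAt_id s).smul_const e).const_sub z)
    have h5 : HasDerivAt (fun s : ℝ => w (z - s • e)) (fderiv ℝ w (z - s • e) (-e)) s :=
      hs.2.hasFDerivAt.comp_hasDerivAt s h4
    rw [h5.deriv, map_neg, ← inner_gradient_left]
    linarith
  rw [hint] at hmono
  simp at hmono
  simp at hz1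
  linarith

lemma SubAE.dirProp {d : ℕ} {F : Ed d → Ed d → ℝ} {μ : ℝ} {w : Ed d → ℝ} (h : SubAE d F μ w) :
    DirProp d F μ w := by
  obtain ⟨⟨C, hC⟩, h2⟩ := h
  intro y e c r hz t ht htr
  refine dir_bound hC y e c r ?_ t ht htr
  filter_upwards [h2] with z hz' hb using hz z hb _ hz'

lemma dir_deriv {d : ℕ} {φ : Ed d → ℝ} {q y e : Ed d} {c : ℝ} (hφ : HasGradientAt φ q y)
    (h : ∀ᶠ s : ℝ in 𝓝[>] 0, φ y - φ (y - s • e) ≤ c * s) : ⟪q, e⟫ ≤ c := by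
  have h4 : HasDerivAt (fun s : ℝ => y - s • e) (-e) 0 := by
    simpa using (((hasDerivAt_id (0:ℝ)).smul_const e).const_sub y)
  have h5 : HasDerivAt (fun s : ℝ => φ (y - s • e)) (-⟪q, e⟫) 0 := by
    have : HasFDerivAt φ (InnerProductSpace.toDual ℝ (Ed d) q) (y - (0:ℝ) • e) := by
      simpa using hφ.hasFDerivAt
    have h := this.comp_hasDerivAt (0:ℝ) h4
    simp at h
    exact h
  have h7 := (hasDerivWithinAt_iff_tendsto_slope' (by simp)).1 (h5.hasDerivWithinAt (s := Set.Ioi 0))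
  have := ge_of_tendsto h7 (b := -c) ?_
  · linarith
  filter_upwards [h, self_mem_nhdsWithin] with s hs hs3
  have hs3' : 0 < s := hs3
  rw [slope_def_field, le_div_iff₀ (by simpa using hs3')]
  simp only [zero_smul, sub_zero]
  linarith

namespace GoodH

variable {d : ℕ} {F : Ed d → Ed d → ℝ} (hF : GoodH d F)
include hF

lemma coer_bd (μ : ℝ) : ∃ R : ℝ, 0 < R ∧ ∀ q y, F q y ≤ μ → ‖q‖ ≤ R := by
  obtain ⟨R, hR⟩ := hF.coer (μ + 1)
  refine ⟨max R 1, by positivity, fun q y h => ?_⟩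
  by_contra hc
  push Not at hc
  have := hR q y ((le_max_left _ _).trans hc.le)
  linarith

lemma uc_both {μ μ' : ℝ} (h : μ < μ') : ∃ δ : ℝ, 0 < δ ∧ ∀ q q' z y, ‖q - q'‖ < δ → ‖z - y‖ < δ →
    F q z ≤ μ → F q' y ≤ μ' := by
  obtain ⟨R, hR0, hR⟩ := hF.coer_bd μ
  obtain ⟨δ, hδ, hh⟩ := hF.uc (R + 1) (by linarith) (μ' - μ) (by linarith)
  refine ⟨min δ 1, by positivity, fun q q' z y h1 h2 h3 => ?_⟩
  have hq := hR q z h3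
  have hq' : ‖q'‖ ≤ R + 1 := by
    have e1 : q' = q - (q - q') := by abel
    have := norm_sub_le q (q - q')
    rw [← e1] at this
    have := h1.trans_le (min_le_right _ _)
    linarith
  have := hh q q' z y (by linarith) hq' (h1.trans_le (min_le_left _ _)) (h2.trans_le (min_le_left _ _))
  rw [abs_lt] at this
  linarith

lemma closed_sub (y : Ed d) (c : ℝ) : IsClosed {q | F q y ≤ c} := by
  have := hF.cont
  have h2 : Continuous fun q : Ed d => F q y := this.comp (by fun_prop : Continuous fun q : Ed d => (q, y))
  exact isClosed_le h2 continuous_const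

lemma convex_sub (y : Ed d) (c : ℝ) : Convex ℝ {q | F q y ≤ c} := by
  rw [convex_iff_segment_subset]
  intro a ha b hb
  rw [segment_eq_image_lineMap]
  rintro _ ⟨t, ht, rfl⟩
  by_contra hcon
  have hlc : Continuous fun s : ℝ => AffineMap.lineMap a b s := AffineMap.lineMap_continuous
  set A : Set ℝ := {s | F (AffineMap.lineMap a b s) y ≤ c} with hA
  have hAc : IsClosed A := (hF.closed_sub y c).preimage hlc
  have h0 : (0:ℝ) ∈ A := by simpa [hA] using ha
  have h1 : (1:ℝ) ∈ A := by simpa [hA] using hb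
  have htA : t ∉ A := hcon
  have hmid : ∀ s ∈ A, ∀ r ∈ A, (s + r) / 2 ∈ A := by
    intro s hs r hr
    have e1 : AffineMap.lineMap a b ((s + r)/2) =
        (1/2:ℝ) • (AffineMap.lineMap a b s + AffineMap.lineMap a b r : Ed d) := by
      simp only [AffineMap.lineMap_apply, vsub_eq_sub, vadd_eq_add]; module
    show F _ y ≤ c
    rw [e1]
    exact (hF.qc _ _ y).trans (max_le hs hr)
  have hs := (hAc.inter isClosed_Iic).csSup_mem (s := A ∩ Set.Iic t) ⟨0, h0, ht.1⟩ ⟨t, fun s hs => hs.2⟩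
  have hr := (hAc.inter isClosed_Ici).csInf_mem (s := A ∩ Set.Ici t) ⟨1, h1, ht.2⟩ ⟨t, fun s hs => hs.2⟩
  set s := sSup (A ∩ Set.Iic t) with hsdef
  set r := sInf (A ∩ Set.Ici t) with hrdef
  have hst : s < t := lt_of_le_of_ne hs.2 (fun h => htA (h ▸ hs.1))
  have htr : t < r := lt_of_le_of_ne hr.2 (fun h => htA (h ▸ hr.1))
  have hm := hmid s hs.1 r hr.1
  rcases le_total ((s + r)/2) t with h | h
  · have := le_csSup (⟨t, fun s hs => hs.2⟩ : BddAbove (A ∩ Set.Iic t)) ⟨hm, h⟩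
    linarith
  · have := csInf_le (⟨t, fun s hs => hs.2⟩ : BddBelow (A ∩ Set.Ici t)) ⟨hm, h⟩
    linarith

lemma sep {q y : Ed d} {M : ℝ} (h : ∀ e c, (∀ q', F q' y ≤ M → ⟪q', e⟫ ≤ c) → ⟪q, e⟫ ≤ c) :
    F q y ≤ M := by
  by_contra hcon
  obtain ⟨f, u, h1, h2⟩ := geometric_hahn_banach_closed_point (hF.convex_sub y M) (hF.closed_sub y M) hcon
  have key : ∀ q' : Ed d, ⟪q', (InnerProductSpace.toDual ℝ (Ed d)).symm f⟫ = f q' := by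
    intro q'; rw [real_inner_comm]; simp
  have := h ((InnerProductSpace.toDual ℝ (Ed d)).symm f) u (fun q' hq' => by
    rw [key]; exact (h1 q' hq').le)
  rw [key] at this
  linarith

lemma touch {μ : ℝ} {f φ : Ed d → ℝ} {q y : Ed d} (hf : DirProp d F μ f) (hφ : HasGradientAt φ q y)
    (hmax : IsLocalMax (fun z => f z - φ z) y) : F q y ≤ μ := by
  refine le_of_forall_gt_imp_ge_of_dense fun μ' hμ' => ?_
  refine hF.sep fun e c hec => ?_
  obtain ⟨r, hr, hrr⟩ := hF.uc_both hμ'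
  have hd := hf y e c r (fun z hz q' hq' => hec q' (hrr q' q' z y (by simpa using hr)
    (by rwa [Metric.mem_ball, dist_eq_norm] at hz) hq'))
  have hc4 : Tendsto (fun s : ℝ => y - s • e) (𝓝[>] 0) (𝓝 y) := by
    have h4 : ContinuousAt (fun s : ℝ => y - s • e) 0 := by fun_prop
    have := h4.tendsto
    simp only [zero_smul, sub_zero] at this
    exact this.mono_left nhdsWithin_le_nhds
  have hsm : ∀ᶠ s : ℝ in 𝓝[>] 0, s * ‖e‖ < r := by
    have : ContinuousAt (fun s : ℝ => s * ‖e‖) 0 := by fun_prop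
    have h8 := this.tendsto.eventually_lt (tendsto_const_nhds (x := r)) (by simpa using hr)
    exact h8.filter_mono nhdsWithin_le_nhds
  refine dir_deriv hφ ?_
  filter_upwards [hc4.eventually hmax, hsm, self_mem_nhdsWithin] with s hs1 hs2 hs3
  have hs3' : 0 < s := hs3
  have := hd s hs3'.le hs2
  linarith

end GoodH

section Calc

variable {d : ℕ}

lemma hg_add {f g : Ed d → ℝ} {a b y : Ed d} (hf : HasGradientAt f a y) (hg : HasGradientAt g b y) :
    HasGradientAt (fun z => f z + g z) (a + b) y := by
  rw [hasGradientAt_iff_hasFDerivAt] at *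
  rw [map_add]; exact hf.add hg

lemma hg_sub {f g : Ed d → ℝ} {a b y : Ed d} (hf : HasGradientAt f a y) (hg : HasGradientAt g b y) :
    HasGradientAt (fun z => f z - g z) (a - b) y := by
  rw [hasGradientAt_iff_hasFDerivAt] at *
  rw [map_sub]; exact hf.sub hg

lemma hg_const_mul {f : Ed d → ℝ} {a y : Ed d} (c : ℝ) (hf : HasGradientAt f a y) :
    HasGradientAt (fun z => c * f z) (c • a) y := by
  rw [hasGradientAt_iff_hasFDerivAt] at *
  have : InnerProductSpace.toDual ℝ (Ed d) (c • a) = c • InnerProductSpace.toDual ℝ (Ed d) a := by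
    simp
  rw [this]; exact hf.const_mul c

lemma hg_inner (p x y : Ed d) : HasGradientAt (fun z => ⟪p, z - x⟫) p y := by
  rw [hasGradientAt_iff_isLittleO]
  have : (fun z : Ed d => ⟪p, z - x⟫ - ⟪p, y - x⟫ - ⟪p, z - y⟫) = fun _ => 0 := by
    funext z
    rw [← inner_sub_right, ← inner_sub_right]; simp
  rw [this]; exact Asymptotics.isLittleO_zero _ _

lemma hg_norm_sq (x y : Ed d) : HasGradientAt (fun z => ‖z - x‖ ^ 2) ((2:ℝ) • (y - x)) y := by
  rw [hasGradientAt_iff_hasFDerivAt]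
  have h1 := (hasStrictFDerivAt_norm_sq (y - x)).hasFDerivAt
  have h2 : HasFDerivAt (fun z : Ed d => z - x) (ContinuousLinearMap.id ℝ (Ed d)) y :=
    (hasFDerivAt_id y).sub_const x
  have h3 := h1.comp y h2
  have e : InnerProductSpace.toDual ℝ (Ed d) ((2:ℝ) • (y - x)) =
      (2 • (innerSL ℝ) (y - x)).comp (ContinuousLinearMap.id ℝ (Ed d)) := by
    ext z; simp
  rw [e]; exact h3

lemma grad_eq_of_touch {f g : Ed d → ℝ} {y : Ed d} (hf : DifferentiableAt ℝ f y)
    (hg : DifferentiableAt ℝ g y) (h : IsLocalMin (fun z => f z - g z) y) :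
    gradient f y = gradient g y := by
  have h1 := h.fderiv_eq_zero
  have h2 : HasFDerivAt (fun z => f z - g z) (fderiv ℝ f y - fderiv ℝ g y) y :=
    hf.hasFDerivAt.sub hg.hasFDerivAt
  rw [h2.fderiv, sub_eq_zero] at h1
  simp only [gradient, h1]

lemma lf_add {f g : Ed d → ℝ} (hf : f ∈ LipFuns d) (hg : g ∈ LipFuns d) :
    (fun z => f z + g z) ∈ LipFuns d := by
  obtain ⟨A, hA⟩ := hf
  obtain ⟨B, hB⟩ := hg
  exact ⟨_, hA.add hB⟩

lemma lf_sub {f g : Ed d → ℝ} (hf : f ∈ LipFuns d) (hg : g ∈ LipFuns d) :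
    (fun z => f z - g z) ∈ LipFuns d := by
  obtain ⟨A, hA⟩ := hf
  obtain ⟨B, hB⟩ := hg
  exact ⟨_, hA.sub hB⟩

lemma lf_max {f g : Ed d → ℝ} (hf : f ∈ LipFuns d) (hg : g ∈ LipFuns d) :
    (fun z => max (f z) (g z)) ∈ LipFuns d := by
  obtain ⟨A, hA⟩ := hf
  obtain ⟨B, hB⟩ := hg
  exact ⟨_, hA.max hB⟩

lemma lf_min {f g : Ed d → ℝ} (hf : f ∈ LipFuns d) (hg : g ∈ LipFuns d) :
    (fun z => min (f z) (g z)) ∈ LipFuns d := by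
  obtain ⟨A, hA⟩ := hf
  obtain ⟨B, hB⟩ := hg
  exact ⟨_, hA.min hB⟩

lemma lf_const (c : ℝ) : (fun _ : Ed d => c) ∈ LipFuns d := ⟨0, LipschitzWith.const c⟩

lemma lf_const_mul {f : Ed d → ℝ} (c : ℝ) (hf : f ∈ LipFuns d) :
    (fun z => c * f z) ∈ LipFuns d := by
  obtain ⟨A, hA⟩ := hf
  refine ⟨‖c‖₊ * A, LipschitzWith.of_dist_le_mul fun a b => ?_⟩
  have := hA.dist_le_mul a b
  rw [Real.dist_eq] at this ⊢
  rw [← mul_sub, abs_mul]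
  push_cast
  rw [mul_assoc]
  exact mul_le_mul_of_nonneg_left this (abs_nonneg c)

lemma lf_norm (x : Ed d) : (fun z : Ed d => ‖z - x‖) ∈ LipFuns d := by
  refine ⟨1, LipschitzWith.of_dist_le_mul fun a b => ?_⟩
  have := abs_norm_sub_norm_le (a - x) (b - x)
  rw [Real.dist_eq, dist_eq_norm]
  simpa using this

lemma lf_inner (p x : Ed d) : (fun z : Ed d => ⟪p, z - x⟫) ∈ LipFuns d := by
  refine ⟨‖p‖₊, LipschitzWith.of_dist_le_mul fun a b => ?_⟩
  rw [Real.dist_eq, dist_eq_norm, ← inner_sub_right]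
  have := abs_real_inner_le_norm p (a - x - (b - x))
  simpa using this

lemma lf_diff {f : Ed d → ℝ} (hf : f ∈ LipFuns d) :
    ∀ᵐ z ∂(volume : Measure (Ed d)), DifferentiableAt ℝ f z := by
  obtain ⟨A, hA⟩ := hf
  exact hA.ae_differentiableAt

lemma lf_cont {f : Ed d → ℝ} (hf : f ∈ LipFuns d) : Continuous f := by
  obtain ⟨A, hA⟩ := hf
  exact hA.continuous

end Calc

namespace GoodH

variable {d : ℕ} {F : Ed d → Ed d → ℝ} (hF : GoodH d F)
include hF

lemma lip_of_dir (μ : ℝ) : ∃ R : ℝ≥0, ∀ f, DirProp d F μ f → LipschitzWith R f := by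
  obtain ⟨R, hR0, hR⟩ := hF.coer_bd μ
  refine ⟨R.toNNReal, fun f hf => LipschitzWith.of_le_add_mul _ fun a b => ?_⟩
  have := hf a (a - b) (R * ‖a - b‖) (‖a - b‖ + 1) (fun z _ q hq => by
    refine (real_inner_le_norm _ _).trans ?_
    exact mul_le_mul_of_nonneg_right (hR q z hq) (norm_nonneg _)) 1 zero_le_one (by linarith)
  simp only [one_smul, sub_sub_cancel, mul_one] at this
  rw [dist_eq_norm]
  rw [Real.coe_toNNReal R hR0.le]
  linarith

lemma sub_of_dir {μ : ℝ} {f : Ed d → ℝ} (hf : DirProp d F μ f) : SubAE d F μ f := by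
  obtain ⟨R, hR⟩ := hF.lip_of_dir μ
  have hL : f ∈ LipFuns d := ⟨R, hR f hf⟩
  refine ⟨hL, ?_⟩
  filter_upwards [lf_diff hL] with z hz
  exact hF.touch hf hz.hasGradientAt (by simp [IsLocalMax, IsMaxFilter])

lemma m_ge {μ : ℝ} {w : Ed d → ℝ} (hw : SubAE d F μ w) (y x : Ed d) :
    w y - w x ≤ mMu d F μ y x := by
  obtain ⟨R, hR⟩ := hF.lip_of_dir μ
  refine le_csSup ⟨R * dist y x, ?_⟩ ⟨w, hw.1, hw.2, rfl⟩
  rintro t ⟨v, hv1, hv2, rfl⟩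
  have := (hR v (SubAE.dirProp ⟨hv1, hv2⟩)).dist_le_mul y x
  rw [Real.dist_eq] at this
  exact (le_abs_self _).trans this

omit hF in
lemma m_le {μ c : ℝ} {w : Ed d → ℝ} (hw : SubAE d F μ w) (y x : Ed d)
    (h : ∀ v, SubAE d F μ v → v y - v x ≤ c) : mMu d F μ y x ≤ c := by
  refine csSup_le ⟨_, w, hw.1, hw.2, rfl⟩ ?_
  rintro t ⟨v, hv1, hv2, rfl⟩
  exact h v ⟨hv1, hv2⟩

lemma m_dir {μ : ℝ} {w : Ed d → ℝ} (hw : SubAE d F μ w) (x : Ed d) :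
    DirProp d F μ (fun y => mMu d F μ y x) := by
  intro y e c r hz t ht htr
  have : mMu d F μ y x ≤ mMu d F μ (y - t • e) x + c * t := by
    refine m_le hw y x fun v hv => ?_
    have h1 := hv.dirProp y e c r hz t ht htr
    have h2 := hF.m_ge hv (y - t • e) x
    linarith
  simp only
  linarith

omit hF in
lemma m_self {μ : ℝ} {w : Ed d → ℝ} (hw : SubAE d F μ w) (x : Ed d) :
    mMu d F μ x x = 0 := by
  have : {t | ∃ w ∈ LipFuns d, (∀ᵐ z ∂(volume : Measure (Ed d)), F (gradient w z) z ≤ μ) ∧ t = w x - w x} = {0} := by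
    ext t
    constructor
    · rintro ⟨v, _, _, rfl⟩; simp
    · intro ht
      exact ⟨w, hw.1, hw.2, by simpa using ht⟩
  unfold mMu
  rw [this]; simp

omit hF in
lemma sub_min {μ : ℝ} {f g : Ed d → ℝ} (hf : SubAE d F μ f) (hg : SubAE d F μ g) :
    SubAE d F μ (fun z => min (f z) (g z)) := by
  have hL := lf_min hf.1 hg.1
  refine ⟨hL, ?_⟩
  filter_upwards [lf_diff hL, lf_diff hf.1, lf_diff hg.1, hf.2, hg.2] with y h1 h2 h3 h4 h5
  rcases le_total (f y) (g y) with h | h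
  · rw [← grad_eq_of_touch h2 h1]
    · exact h4
    · refine Eventually.of_forall fun z => ?_
      simp [h]
  · rw [← grad_eq_of_touch h3 h1]
    · exact h5
    · refine Eventually.of_forall fun z => ?_
      simp [h]

lemma sub_viscSub {μ : ℝ} {f : Ed d → ℝ} (hf : SubAE d F μ f) (x : Ed d) :
    ViscSub d F μ ({x}ᶜ) f := by
  intro φ x0 hx0 hφ hmax
  refine hF.touch hf.dirProp (hφ.differentiableAt (by simp)).hasGradientAt ?_
  exact hmax.isLocalMax (isOpen_compl_singleton.mem_nhds hx0)

lemma viscSub_sub (hd : 0 < d) {μ : ℝ} {v : Ed d → ℝ} (hv : v ∈ LipFuns d) (x : Ed d)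
    (h : ViscSub d F μ ({x}ᶜ) v) : SubAE d F μ v := by
  refine ⟨hv, ?_⟩
  have : Nonempty (Fin d) := ⟨⟨0, hd⟩⟩
  have hne : ∀ᵐ z ∂(volume : Measure (Ed d)), z ∈ ({x}ᶜ : Set (Ed d)) :=
    compl_mem_ae_iff.2 (measure_singleton x)
  filter_upwards [lf_diff hv, hne] with z hz hzx
  refine le_of_forall_gt_imp_ge_of_dense fun μ' hμ' => ?_
  obtain ⟨δ, hδ, hδδ⟩ := hF.uc_both hμ'
  set q := gradient v z with hq
  have hlo := hasGradientAt_iff_isLittleO.1 hz.hasGradientAt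
  have hev := hlo.def (show (0:ℝ) < δ / 12 by positivity)
  obtain ⟨r0, hr0, hr0'⟩ := Metric.eventually_nhds_iff.1
    (hev.and (isOpen_compl_singleton.mem_nhds hzx))
  set r := min (r0 / 2) (δ / 2) with hr
  have hrpos : 0 < r := by positivity
  have hrr0 : r < r0 := (min_le_left _ _).trans_lt (by linarith)
  have hrδ : r < δ := (min_le_right _ _).trans_lt (by linarith)
  set φ : Ed d → ℝ := fun y => ⟪q, y - z⟫ + (δ / 4 / r) * ‖y - z‖ ^ 2 with hφ
  have hvc := lf_cont hv
  have hφc : Continuous φ := by fun_prop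
  obtain ⟨y1, hy1, hy1max⟩ := (isCompact_closedBall z r).exists_isMaxOn
    ⟨z, Metric.mem_closedBall_self hrpos.le⟩ ((hvc.sub hφc).continuousOn)
  rw [Metric.mem_closedBall, dist_eq_norm] at hy1
  have hz1 := hy1max (Metric.mem_closedBall_self hrpos.le)
  simp only [Set.mem_ofPred_eq, Pi.sub_apply, hφ, sub_self, inner_zero_right, norm_zero] at hz1
  have hy1r : ‖y1 - z‖ < r := by
    refine lt_of_le_of_ne hy1 fun heq => ?_
    have h1 := (hr0' (y := y1) (by rw [dist_eq_norm]; linarith)).1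
    rw [Real.norm_eq_abs, abs_le, heq] at h1
    have h2 : δ / 4 / r * r ^ 2 = δ / 4 * r := by field_simp
    rw [heq, h2] at hz1
    have : 0 < δ * r := by positivity
    nlinarith [h1.2]
  have hgrad : ∀ y, HasGradientAt φ (q + (δ / 4 / r) • ((2:ℝ) • (y - z))) y := fun y =>
    hg_add (hg_inner q z y) (hg_const_mul _ (hg_norm_sq z y))
  have hmem : y1 ∈ ({x}ᶜ : Set (Ed d)) := (hr0' (y := y1) (by rw [dist_eq_norm]; linarith)).2
  have hcd : ContDiffAt ℝ 1 φ y1 := by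
    have h1 : ContDiff ℝ 1 (fun y : Ed d => y - z) := contDiff_id.sub contDiff_const
    have h2 : ContDiff ℝ 1 φ :=
      (contDiff_const.inner ℝ h1).add (contDiff_const.mul (h1.norm_sq ℝ))
    exact h2.contDiffAt
  have hres := h φ y1 hmem hcd (by
    have : IsLocalMax (fun y => v y - φ y) y1 := by
      have hb : Metric.ball z r ∈ 𝓝 y1 := Metric.isOpen_ball.mem_nhds (by
        rw [Metric.mem_ball, dist_eq_norm]; exact hy1r)
      filter_upwards [hb] with y hy
      exact hy1max (Metric.ball_subset_closedBall hy)
    exact this.on _)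
  rw [(hgrad y1).gradient] at hres
  refine hδδ _ q y1 z ?_ (hy1r.trans hrδ) hres
  have : q + (δ / 4 / r) • ((2:ℝ) • (y1 - z)) - q = (δ / 4 / r * 2) • (y1 - z) := by module
  rw [this, norm_smul, Real.norm_eq_abs, abs_of_pos (by positivity)]
  have h3 : δ / 4 / r * 2 * r = δ / 2 := by field_simp; ring
  have h4 : δ / 4 / r * 2 * ‖y1 - z‖ ≤ δ / 4 / r * 2 * r :=
    mul_le_mul_of_nonneg_left hy1r.le (by positivity)
  linarith

lemma bump {μ : ℝ} {m φ : Ed d → ℝ} {x x0 q : Ed d} (hx0 : x0 ≠ x) (hm : SubAE d F μ m) (hmx : m x = 0)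
    (hmax : ∀ W, SubAE d F μ W → W x0 - W x ≤ m x0) (hφ : HasGradientAt φ q x0)
    (hmin : IsLocalMin (fun y => m y - φ y) x0) : μ ≤ F q x0 := by
  by_contra hcon
  push Not at hcon
  obtain ⟨δ, hδ, hδδ⟩ := hF.uc_both hcon
  set θ := δ / 2 with hθ
  have hθ0 : 0 < θ := by positivity
  have hev := (hasGradientAt_iff_isLittleO.1 hφ).def (show (0:ℝ) < θ / 2 by positivity)
  obtain ⟨r0, hr0, hr0'⟩ := Metric.eventually_nhds_iff.1 (hev.and hmin)
  set r := min r0 (min δ ‖x - x0‖) with hr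
  have hxx0 : 0 < ‖x - x0‖ := norm_pos_iff.2 (sub_ne_zero.2 hx0.symm)
  have hrpos : 0 < r := by positivity
  have hrr0 : r ≤ r0 := min_le_left _ _
  have hrδ : r ≤ δ := (min_le_right _ _).trans (min_le_left _ _)
  have hrx : r ≤ ‖x - x0‖ := (min_le_right _ _).trans (min_le_right _ _)
  obtain ⟨C, hC⟩ := hm.1
  set κ := θ * r / 8 with hκ
  have hκ0 : 0 < κ := by positivity
  set L := 2 * (‖q‖ + C + θ) with hL
  have hL0 : 0 ≤ L := by positivity
  set ψ : Ed d → ℝ := fun y => m x0 + κ + ⟪q, y - x0⟫ - θ * ‖y - x0‖ -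
    L * max 0 (‖y - x0‖ - r / 2) with hψ
  have hψL : ψ ∈ LipFuns d :=
    lf_sub (lf_sub (lf_add (lf_const _) (lf_inner q x0)) (lf_const_mul _ (lf_norm x0)))
      (lf_const_mul _ (lf_max (lf_const 0) (lf_sub (lf_norm x0) (lf_const _))))
  have hfar : ∀ y, r / 2 ≤ ‖y - x0‖ → ψ y < m y := by
    intro y hy
    rcases lt_or_ge ‖y - x0‖ r with h | h
    · obtain ⟨h1, h2⟩ := hr0' (y := y) (by rw [dist_eq_norm]; linarith)
      rw [Real.norm_eq_abs, abs_le] at h1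
      have h3 : 0 ≤ L * max 0 (‖y - x0‖ - r / 2) := mul_nonneg hL0 (le_max_left _ _)
      have h4 : θ * (r / 2) ≤ θ * ‖y - x0‖ := mul_le_mul_of_nonneg_left hy hθ0.le
      have h5 : 0 < θ * r := by positivity
      simp only [hψ]
      linarith [h1.1]
    · have h1 := hC.dist_le_mul x0 y
      rw [Real.dist_eq, dist_eq_norm, norm_sub_rev] at h1
      have h1' := (le_abs_self _).trans h1
      have h2 : L * (‖y - x0‖ / 2) ≤ L * max 0 (‖y - x0‖ - r / 2) :=
        mul_le_mul_of_nonneg_left (le_max_of_le_right (by linarith)) hL0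
      have h3 := real_inner_le_norm q (y - x0)
      have h4 : θ * r ≤ θ * ‖y - x0‖ := mul_le_mul_of_nonneg_left h hθ0.le
      have h5 : 0 < θ * r := by positivity
      have h6 : L * (‖y - x0‖ / 2) = ‖q‖ * ‖y - x0‖ + C * ‖y - x0‖ + θ * ‖y - x0‖ := by
        rw [hL]; ring
      simp only [hψ]
      linarith
  have hWL := lf_max hm.1 hψL
  have hW : SubAE d F μ (fun z => max (m z) (ψ z)) := by
    refine ⟨hWL, ?_⟩
    filter_upwards [lf_diff hWL, lf_diff hm.1, lf_diff hψL, hm.2] with y h1 h2 h3 h4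
    rcases le_or_gt (ψ y) (m y) with h | h
    · rw [grad_eq_of_touch h1 h2]
      · exact h4
      · refine Eventually.of_forall fun z => ?_
        simp [h]
    · rw [grad_eq_of_touch h1 h3]
      · have hy : ‖y - x0‖ < r / 2 := by
          by_contra hc
          exact absurd (hfar y (not_lt.1 hc)) (not_lt.2 h.le)
        have hg := hg_sub h3.hasGradientAt (hg_inner q x0 y)
        have hn : ‖gradient ψ y - q‖ ≤ θ := by
          have := hg.hasFDerivAt.le_of_lip' hθ0.le (by
            have hb : Metric.ball x0 (r / 2) ∈ 𝓝 y := Metric.isOpen_ball.mem_nhds (by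
              rw [Metric.mem_ball, dist_eq_norm]; exact hy)
            filter_upwards [hb] with z hz
            rw [Metric.mem_ball, dist_eq_norm] at hz
            have e1 : max 0 (‖z - x0‖ - r / 2) = 0 := max_eq_left (by linarith)
            have e2 : max 0 (‖y - x0‖ - r / 2) = 0 := max_eq_left (by linarith)
            simp only [hψ, e1, e2]
            have e3 : m x0 + κ + ⟪q, z - x0⟫ - θ * ‖z - x0‖ - L * 0 - ⟪q, z - x0⟫ -
              (m x0 + κ + ⟪q, y - x0⟫ - θ * ‖y - x0‖ - L * 0 - ⟪q, y - x0⟫) =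
              - (θ * (‖z - x0‖ - ‖y - x0‖)) := by ring
            rw [e3, norm_neg, norm_mul, Real.norm_eq_abs θ, abs_of_pos hθ0]
            refine mul_le_mul_of_nonneg_left ?_ hθ0.le
            have := abs_norm_sub_norm_le (z - x0) (y - x0)
            simpa using this)
          rwa [LinearIsometryEquiv.norm_map] at this
        refine hδδ q _ x0 y ?_ ?_ le_rfl
        · rw [norm_sub_rev]; linarith
        · rw [norm_sub_rev]; linarith
      · refine Eventually.of_forall fun z => ?_
        simp [h.le]
  have h1 := hmax _ hW
  have h2 : ψ x0 = m x0 + κ := by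
    have : max 0 (-(r / 2)) = 0 := max_eq_left (by linarith)
    simp [hψ, this]
  have h3 := hfar x (by linarith)
  have h4 : max (m x) (ψ x) = 0 := by rw [max_eq_left h3.le, hmx]
  have h5 : m x0 + κ ≤ max (m x0) (ψ x0) := by rw [← h2]; exact le_max_right _ _
  linarith

lemma m_super {μ : ℝ} {w : Ed d → ℝ} (hw : SubAE d F μ w) (x : Ed d) :
    ViscSuper d F μ ({x}ᶜ) (fun y => mMu d F μ y x) := by
  intro φ x0 hx0 hφ hmin
  have hmin' := hmin.isLocalMin (isOpen_compl_singleton.mem_nhds hx0)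
  exact hF.bump (m := fun y => mMu d F μ y x) hx0 (hF.sub_of_dir (hF.m_dir hw x)) (m_self hw x)
    (fun W hW => hF.m_ge hW x0 x) (hφ.differentiableAt (by simp)).hasGradientAt hmin'

end GoodH

namespace GoodH

variable {d : ℕ} {F : Ed d → Ed d → ℝ} (hF : GoodH d F)
include hF

lemma mollify {μ μ' ε : ℝ} {ζ : Ed d → ℝ} (hζ : SubAE d F μ ζ) (hμ : μ < μ') (hε : 0 < ε) :
    ∃ g : Ed d → ℝ, ContDiff ℝ 1 g ∧ (∀ y, |g y - ζ y| ≤ ε) ∧ ∀ y, F (gradient g y) y ≤ μ' := by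
  obtain ⟨δ, hδ, hδδ⟩ := hF.uc_both hμ
  obtain ⟨C, hC⟩ := hζ.1
  have hζc : Continuous ζ := hC.continuous
  set ρ := min (δ / 2) (ε / (C + 1)) with hρ
  have hρ0 : 0 < ρ := by positivity
  let φ : ContDiffBump (0 : Ed d) := ⟨ρ / 2, ρ, by positivity, by linarith⟩
  have hrout : φ.rOut = ρ := rfl
  set g : Ed d → ℝ := convolution (φ.normed volume) ζ (ContinuousLinearMap.lsmul ℝ ℝ) volume with hg
  have hgC : ContDiff ℝ 1 g :=
    φ.hasCompactSupport_normed.contDiff_convolution_left (n := 1) _ φ.contDiff_normed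
      hζc.locallyIntegrable
  refine ⟨g, hgC, fun y => ?_, fun y => ?_⟩
  · have := φ.dist_normed_convolution_le (μ := volume) (g := ζ) (x₀ := y) (ε := ε)
      hζc.aestronglyMeasurable (fun z hz => by
        rw [hrout, Metric.mem_ball] at hz
        refine (hC.dist_le_mul z y).trans ?_
        have h1 : dist z y ≤ ε / (C + 1) := hz.le.trans (min_le_right _ _)
        have h2 : (C : ℝ) * dist z y ≤ (C + 1) * dist z y :=
          mul_le_mul_of_nonneg_right (by linarith) dist_nonneg
        have h3 : ((C : ℝ) + 1) * dist z y ≤ (C + 1) * (ε / (C + 1)) :=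
          mul_le_mul_of_nonneg_left h1 (by positivity)
        have h4 : ((C : ℝ) + 1) * (ε / (C + 1)) = ε := by field_simp
        linarith)
    rwa [Real.dist_eq] at this
  · refine hF.sep fun e c hec => ?_
    refine dir_deriv (((hgC.differentiable (by simp)) y).hasGradientAt) ?_
    have hsm : ∀ᶠ s : ℝ in 𝓝[>] 0, s * ‖e‖ < δ / 2 := by
      have : ContinuousAt (fun s : ℝ => s * ‖e‖) 0 := by fun_prop
      have h8 := this.tendsto.eventually_lt (tendsto_const_nhds (x := δ / 2)) (by simpa using hδ)
      exact h8.filter_mono nhdsWithin_le_nhds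
    filter_upwards [hsm, self_mem_nhdsWithin] with s hs1 hs2
    have hs2' : 0 < s := hs2
    have hint : ∀ a : Ed d, Integrable (fun t => φ.normed volume t * ζ (a - t)) volume := by
      intro a
      refine Continuous.integrable_of_hasCompactSupport ?_ ?_
      · exact φ.continuous_normed.mul (by fun_prop)
      · exact φ.hasCompactSupport_normed.mul_right
    have hgy : ∀ a, g a = ∫ t, φ.normed volume t * ζ (a - t) := fun a => by
      simp [hg, convolution]
    rw [hgy, hgy, ← integral_sub (hint _) (hint _)]
    have h1 : ∫ t, φ.normed volume t * (c * s) = c * s := by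
      rw [integral_mul_const, φ.integral_normed, one_mul]
    rw [← h1]
    refine integral_mono ((hint _).sub (hint _)) (φ.integrable_normed.mul_const _) fun t => ?_
    show φ.normed volume t * ζ (y - t) - φ.normed volume t * ζ (y - s • e - t) ≤ _
    rw [← mul_sub]
    by_cases ht : t ∈ Metric.ball (0 : Ed d) ρ
    · refine mul_le_mul_of_nonneg_left ?_ (φ.nonneg_normed t)
      have e1 : y - s • e - t = y - t - s • e := by abel
      rw [e1]
      refine hζ.dirProp (y - t) e c (δ / 2) (fun z hz q hq => hec q (hδδ q q z y (by simpa using hδ) ?_ hq))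
        s hs2'.le hs1
      rw [Metric.mem_ball, dist_eq_norm] at hz
      rw [mem_ball_zero_iff] at ht
      have h2 : z - y = (z - (y - t)) - t := by abel
      have h3 := norm_sub_le (z - (y - t)) t
      have h4 : ρ ≤ δ / 2 := min_le_left _ _
      rw [h2]; linarith
    · have : φ.normed volume t = 0 := by
        have h5 := φ.support_normed_eq (μ := (volume : Measure (Ed d)))
        by_contra h6
        have h7 : t ∈ Function.support (φ.normed volume) := h6
        rw [h5] at h7
        exact ht h7
      simp [this]

lemma compare {μ μ' : ℝ} {ζ u : Ed d → ℝ} {x : Ed d} (hζ : SubAE d F μ' ζ) (hμ : μ' < μ)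
    (hu : u ∈ LipFuns d) (hsup : ViscSuper d F μ ({x}ᶜ) u)
    (hinf : Tendsto (fun y => ζ y - u y) (cocompact (Ed d)) atBot) (y : Ed d) :
    ζ y - u y ≤ ζ x - u x := by
  refine le_of_forall_pos_le_add fun ε hε => ?_
  obtain ⟨g, hgC, hgε, hgF⟩ := hF.mollify hζ (show μ' < (μ' + μ) / 2 by linarith)
    (show 0 < ε / 2 by positivity)
  have huc := lf_cont hu
  have hcont : Continuous fun y => g y - u y := hgC.continuous.sub huc
  have htend : Tendsto (fun y => g y - u y) (cocompact (Ed d)) atBot := by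
    refine tendsto_atBot_mono (fun z => ?_) (tendsto_atBot_add_const_right _ (ε / 2) hinf)
    have := (abs_le.1 (hgε z)).2
    linarith
  obtain ⟨y0, hy0⟩ := hcont.exists_forall_ge htend
  have hy0x : y0 = x := by
    by_contra hne
    have h1 := hsup g y0 hne hgC.contDiffAt (by
      refine IsLocalMin.on (f := fun y => u y - g y) (Eventually.of_forall fun z => ?_) _
      have := hy0 z
      simp only
      linarith)
    have h2 := hgF y0
    linarith
  subst hy0x
  have h1 := hy0 y
  have h2 := abs_le.1 (hgε y)
  have h3 := abs_le.1 (hgε y0)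
  linarith [h2.1, h3.2]

lemma perturb {μ μ' : ℝ} {ζ : Ed d → ℝ} (hζ : SubAE d F μ ζ) (hμ : μ < μ') (x : Ed d) :
    ∃ δ₀ : ℝ, 0 < δ₀ ∧ ∀ δ, 0 < δ → δ < δ₀ → SubAE d F μ' (fun y => ζ y - δ * ‖y - x‖) := by
  obtain ⟨δ₀, hδ₀, hh⟩ := hF.uc_both hμ
  refine ⟨δ₀, hδ₀, fun δ h1 h2 => ?_⟩
  have hL := lf_const_mul δ (lf_norm x)
  refine ⟨lf_sub hζ.1 hL, ?_⟩
  filter_upwards [lf_diff hζ.1, lf_diff (lf_norm x), hζ.2] with y hy1 hy2 hy3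
  rw [(hg_sub hy1.hasGradientAt (hg_const_mul δ hy2.hasGradientAt)).gradient]
  refine hh _ _ y y ?_ (by simpa using hδ₀) hy3
  have h3 : ‖gradient (fun z : Ed d => ‖z - x‖) y‖ ≤ 1 := by
    refine hy2.hasGradientAt.hasFDerivAt.le_of_lip' zero_le_one
      (Eventually.of_forall fun z => ?_) |> fun h => by rwa [LinearIsometryEquiv.norm_map] at h
    have := abs_norm_sub_norm_le (z - x) (y - x)
    simpa using this
  rw [sub_sub_cancel, norm_smul, Real.norm_eq_abs, abs_of_pos h1]
  have := mul_le_mul_of_nonneg_left h3 h1.le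
  linarith

lemma half {μ μ₁ : ℝ} {f g : Ed d → ℝ} (hf : SubAE d F μ f) (hg : SubAE d F μ₁ g) (hμ : μ₁ < μ) :
    ∃ μ₂, μ₂ < μ ∧ SubAE d F μ₂ (fun y => (1/2 : ℝ) * (f y + g y)) := by
  obtain ⟨μ₂, h2, h3⟩ := hF.strict μ μ₁ hμ
  refine ⟨μ₂, h2, lf_const_mul _ (lf_add hf.1 hg.1), ?_⟩
  filter_upwards [lf_diff hf.1, lf_diff hg.1, hf.2, hg.2] with y hy1 hy2 hy3 hy4
  rw [(hg_const_mul (1/2) (hg_add hy1.hasGradientAt hy2.hasGradientAt)).gradient]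
  exact h3 _ _ y hy3 hy4

lemma good_le {μ μ' T : ℝ} {u w z : Ed d → ℝ} {x : Ed d} (hu : u ∈ SLplus d) (hux : u x = 0)
    (hsup : ViscSuper d F μ ({x}ᶜ) u) (hw : w ∈ SLminus d) (hz : SubAE d F μ' z) (hμ : μ' < μ)
    (hzT : ∀ y, z y ≤ w y + T) (hzx : z x = 0) (y : Ed d) : z y ≤ u y := by
  obtain ⟨δ₀, hδ₀, hh⟩ := hF.perturb hz (show μ' < (μ' + μ) / 2 by linarith) x
  have key : ∀ δ, 0 < δ → δ < δ₀ → z y - δ * ‖y - x‖ ≤ u y := by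
    intro δ h1 h2
    have hs := hh δ h1 h2
    have := hF.compare hs (show (μ' + μ) / 2 < μ by linarith) hu.1 hsup ?_ y
    · simp only [hzx, hux, sub_self, norm_zero, mul_zero] at this
      linarith
    obtain ⟨R1, hR1⟩ := hu.2 (δ / 4) (by positivity)
    obtain ⟨R2, hR2⟩ := hw.2 (δ / 4) (by positivity)
    have ht : Tendsto (fun y : Ed d => (T + δ * ‖x‖) - (δ / 2) * ‖y‖) (cocompact (Ed d)) atBot := by
      have := (tendsto_norm_cocompact_atTop (E := Ed d)).const_mul_atTop (show 0 < δ / 2 by positivity)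
      exact tendsto_atBot_add_const_left _ _ (tendsto_neg_atTop_atBot.comp this)
    refine tendsto_atBot_mono' _ ?_ ht
    filter_upwards [(tendsto_norm_cocompact_atTop (E := Ed d)).eventually_ge_atTop (max (max R1 R2) 1)]
      with a ha
    have ha0 : 0 < ‖a‖ := by
      have := (le_max_right (max R1 R2) 1).trans ha
      linarith
    have e1 := hR1 a (((le_max_left _ _).trans (le_max_left _ _)).trans ha)
    have e2 := hR2 a (((le_max_right _ _).trans (le_max_left _ _)).trans ha)
    rw [le_div_iff₀ ha0] at e1
    rw [div_le_iff₀ ha0] at e2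
    have e3 := hzT a
    have e4 : ‖a‖ - ‖x‖ ≤ ‖a - x‖ := norm_sub_norm_le a x
    have e5 := mul_le_mul_of_nonneg_left e4 h1.le
    linarith
  have hlim : Tendsto (fun δ : ℝ => z y - δ * ‖y - x‖) (𝓝[>] 0) (𝓝 (z y)) := by
    have h1 : ContinuousAt (fun δ : ℝ => z y - δ * ‖y - x‖) 0 := by fun_prop
    have := h1.tendsto
    simp only [zero_mul, sub_zero] at this
    exact this.mono_left nhdsWithin_le_nhds
  refine le_of_tendsto hlim ?_
  filter_upwards [self_mem_nhdsWithin, nhdsWithin_le_nhds (Iio_mem_nhds hδ₀)] with δ h1 h2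
  exact key δ h1 h2

lemma m_le_super {μ μ' : ℝ} {u w : Ed d → ℝ} {x : Ed d} (hu : u ∈ SLplus d) (hux : u x = 0)
    (hsup : ViscSuper d F μ ({x}ᶜ) u) (hw : w ∈ SLminus d) (hws : SubAE d F μ' w) (hμ : μ' < μ)
    (y : Ed d) : mMu d F μ y x ≤ u y := by
  have hwμ : SubAE d F μ w := ⟨hws.1, hws.2.mono fun z hz => hz.trans hμ.le⟩
  have hshift : ∀ (ν c : ℝ), SubAE d F ν w → SubAE d F ν (fun z => w z + c) := by
    intro ν c h
    refine ⟨lf_add h.1 (lf_const c), ?_⟩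
    filter_upwards [lf_diff h.1, h.2] with z hz1 hz2
    rw [(hg_add hz1.hasGradientAt (hasGradientAt_const z c)).gradient]
    simpa using hz2
  set T := |mMu d F μ y x - w y + w x| with hT
  have hT0 : 0 ≤ T := abs_nonneg _
  set m : Ed d → ℝ := fun z => mMu d F μ z x with hm
  have hmx : m x = 0 := m_self hwμ x
  set zT : Ed d → ℝ := fun z => min (m z) (w z + (T - w x)) with hzT
  have hzTs : SubAE d F μ zT := sub_min (hF.sub_of_dir (hF.m_dir hwμ x)) (hshift μ _ hwμ)
  have hind : ∀ k : ℕ, ∃ ν, ν < μ ∧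
      SubAE d F ν (fun z => zT z + (1/2 : ℝ) ^ k * (w z - w x - zT z)) := by
    intro k
    induction k with
    | zero =>
      refine ⟨μ', hμ, ?_⟩
      convert hshift μ' (- w x) hws using 2 with z
      ring
    | succ k ih =>
      obtain ⟨ν, hν, hk⟩ := ih
      obtain ⟨ν₂, h1, h2⟩ := hF.half hzTs hk hν
      refine ⟨ν₂, h1, ?_⟩
      convert h2 using 2 with z
      ring
  have hzTx : zT x = 0 := by
    simp only [hzT, hmx]
    exact min_eq_left (by linarith)
  have hk : ∀ k : ℕ, zT y + (1/2 : ℝ) ^ k * (w y - w x - zT y) ≤ u y := by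
    intro k
    obtain ⟨ν, h1, h2⟩ := hind k
    refine hF.good_le (T := T - w x) hu hux hsup hw h2 h1 (fun z => ?_) ?_ y
    · have e1 : zT z ≤ w z + (T - w x) := min_le_right _ _
      have e2 : (0:ℝ) ≤ (1/2 : ℝ) ^ k := by positivity
      have e3 : (1/2 : ℝ) ^ k ≤ 1 := pow_le_one₀ (by norm_num) (by norm_num)
      nlinarith
    · rw [hzTx]; ring
  have hlim : Tendsto (fun k : ℕ => zT y + (1/2 : ℝ) ^ k * (w y - w x - zT y)) atTop (𝓝 (zT y)) := by
    have := (tendsto_pow_atTop_nhds_zero_of_lt_one (show (0:ℝ) ≤ 1/2 by norm_num)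
      (show (1/2:ℝ) < 1 by norm_num)).mul_const (w y - w x - zT y)
    simpa using this.const_add (zT y)
  have h1 := le_of_tendsto' hlim hk
  have h2 : zT y = mMu d F μ y x := by
    refine min_eq_left ?_
    have := le_abs_self (mMu d F μ y x - w y + w x)
    simp only [hm]
    linarith
  linarith

lemma core (hd : 0 < d) {μ μ' : ℝ} {w : Ed d → ℝ} (hw : w ∈ Scal d) (hws : SubAE d F μ' w)
    (hμ : μ' < μ) (x : Ed d) :
    ((fun y => mMu d F μ y x) ∈ SLplus d ∧ mMu d F μ x x = 0 ∧
      ViscSub d F μ ({x}ᶜ) (fun y => mMu d F μ y x) ∧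
      ViscSuper d F μ ({x}ᶜ) (fun y => mMu d F μ y x)) ∧
    ∀ v : Ed d → ℝ, v ∈ SLplus d → v x = 0 →
      ViscSub d F μ ({x}ᶜ) v → ViscSuper d F μ ({x}ᶜ) v → v = fun y => mMu d F μ y x := by
  have hwμ : SubAE d F μ w := ⟨hws.1, hws.2.mono fun z hz => hz.trans hμ.le⟩
  have hmsub := hF.sub_of_dir (hF.m_dir hwμ x)
  refine ⟨⟨⟨hmsub.1, fun ε hε => ?_⟩, m_self hwμ x, hF.sub_viscSub hmsub x, hF.m_super hwμ x⟩, ?_⟩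
  · obtain ⟨R, hR⟩ := hw.1.2 (ε / 2) (by positivity)
    refine ⟨max R (max 1 (2 * |w x| / ε)), fun y hy => ?_⟩
    have h1 : 1 ≤ ‖y‖ := ((le_max_left _ _).trans (le_max_right _ _)).trans hy
    have h2 : 2 * |w x| / ε ≤ ‖y‖ := ((le_max_right _ _).trans (le_max_right _ _)).trans hy
    have h3 := hR y ((le_max_left _ _).trans hy)
    have h0 : 0 < ‖y‖ := by linarith
    rw [le_div_iff₀ h0] at h3 ⊢
    rw [div_le_iff₀ hε] at h2
    have h4 := hF.m_ge hwμ y x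
    have h5 := le_abs_self (w x)
    linarith
  · intro v hv hvx hsub hsup
    funext y
    refine le_antisymm ?_ (hF.m_le_super hv hvx hsup hw.2 hws hμ y)
    have := hF.m_ge (hF.viscSub_sub hd hv.1 x hsub) y x
    rw [hvx] at this
    linarith

end GoodH

lemma GoodH.shift {d : ℕ} {H : Ed d → Ed d → ℝ} (hH : GoodH d H) (p : Ed d) :
    GoodH d (fun q y => H (p + q) y) := by
  have e : ∀ q q' : Ed d, p + (1/2 : ℝ) • (q + q') = (1/2 : ℝ) • ((p + q) + (p + q')) := by
    intro q q'; module
  constructor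
  · exact hH.cont.comp (by fun_prop : Continuous fun q : Ed d × Ed d => (p + q.1, q.2))
  · intro R hR
    obtain ⟨M, hM⟩ := hH.bdd (‖p‖ + R) (by positivity)
    exact ⟨M, fun q y hq => hM _ y ((norm_add_le _ _).trans (by linarith))⟩
  · intro R hR ε hε
    obtain ⟨δ, hδ, h⟩ := hH.uc (‖p‖ + R) (by positivity) ε hε
    refine ⟨δ, hδ, fun q q' y y' h1 h2 h3 h4 => h _ _ y y' ((norm_add_le _ _).trans (by linarith))
      ((norm_add_le _ _).trans (by linarith)) (by simpa using h3) h4⟩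
  · intro M
    obtain ⟨R, hR⟩ := hH.coer M
    refine ⟨R + ‖p‖, fun q y hq => hR _ y ?_⟩
    have := norm_sub_le (p + q) p
    rw [add_sub_cancel_left] at this
    linarith
  · intro q q' y
    simp only [e]
    exact hH.qc _ _ y
  · intro μ μ₁ h
    obtain ⟨μ₂, h1, h2⟩ := hH.strict μ μ₁ h
    refine ⟨μ₂, h1, fun q q' y h3 h4 => ?_⟩
    simp only [e]
    exact h2 _ _ y h3 h4

lemma sub_shift {d : ℕ} {H : Ed d → Ed d → ℝ} {p : Ed d} {μ : ℝ} {w : Ed d → ℝ}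
    (hw : SubAE d (fun q y => H (p + q) y) μ w) (x : Ed d) :
    SubAE d H μ (fun y => w y + ⟪p, y - x⟫) := by
  refine ⟨lf_add hw.1 (lf_inner p x), ?_⟩
  filter_upwards [lf_diff hw.1, hw.2] with z h1 h2
  rw [(hg_add h1.hasGradientAt (hg_inner p x z)).gradient, add_comm]
  exact h2

lemma sub_unshift {d : ℕ} {H : Ed d → Ed d → ℝ} {p : Ed d} {μ : ℝ} {w : Ed d → ℝ}
    (hw : SubAE d H μ w) (x : Ed d) :
    SubAE d (fun q y => H (p + q) y) μ (fun y => w y - ⟪p, y - x⟫) := by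
  refine ⟨lf_sub hw.1 (lf_inner p x), ?_⟩
  filter_upwards [lf_diff hw.1, hw.2] with z h1 h2
  rw [(hg_sub h1.hasGradientAt (hg_inner p x z)).gradient, add_sub_cancel]
  exact h2

lemma zero_mem_Scal (d : ℕ) : (fun _ : Ed d => (0:ℝ)) ∈ Scal d := by
  refine ⟨⟨lf_const 0, fun ε hε => ⟨0, fun y _ => ?_⟩⟩, ⟨lf_const 0, fun ε hε => ⟨0, fun y _ => ?_⟩⟩⟩
  · simp [hε.le]
  · simp [hε.le]

/-- m_μ(·,x) − p·(·−x) is the unique solution of the metric problem in SL⁺. -/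
theorem statement_9
    (d : ℕ) (hd : 0 < d)
    (H : Ed d → Ed d → ℝ)
    (hHcont : Continuous fun q : Ed d × Ed d => H q.1 q.2)
    (hreg_bdd : ∀ R : ℝ, 0 < R → ∃ M : ℝ, ∀ p y : Ed d, ‖p‖ ≤ R → |H p y| ≤ M)
    (hreg_uc : ∀ R : ℝ, 0 < R → ∀ ε : ℝ, 0 < ε → ∃ δ : ℝ, 0 < δ ∧ ∀ p p' y y' : Ed d,
      ‖p‖ ≤ R → ‖p'‖ ≤ R → ‖p - p'‖ < δ → ‖y - y'‖ < δ → |H p y - H p' y'| < ε)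
    (hcoer : ∀ M : ℝ, ∃ R : ℝ, ∀ p y : Ed d, R ≤ ‖p‖ → M ≤ H p y)
    (hqc : ∀ p q y : Ed d, H ((1/2 : ℝ) • (p + q)) y ≤ max (H p y) (H q y))
    (Λ : ℝ → ℝ → ℝ)
    (hΛcont : Continuous fun m : ℝ × ℝ => Λ m.1 m.2)
    (hΛmono : ∀ a b a' b' : ℝ, a ≤ a' → b ≤ b' → Λ a b ≤ Λ a' b')
    (hΛstrict : ∀ a b : ℝ, a ≠ b → Λ a b < max a b)
    (hsqc : ∀ p q y : Ed d, H ((1/2 : ℝ) • (p + q)) y ≤ Λ (H p y) (H q y))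
    (p x : Ed d) (μ : ℝ) (hμ : Hhat d H p < μ) :
    ((fun y => mMu d H μ y x - ⟪p, y - x⟫) ∈ SLplus d ∧
      mMu d H μ x x - ⟪p, x - x⟫ = 0 ∧
      ViscSub d (fun q y => H (p + q) y) μ ({x}ᶜ) (fun y => mMu d H μ y x - ⟪p, y - x⟫) ∧
      ViscSuper d (fun q y => H (p + q) y) μ ({x}ᶜ) (fun y => mMu d H μ y x - ⟪p, y - x⟫)) ∧
    ∀ v : Ed d → ℝ, v ∈ SLplus d → v x = 0 →
      ViscSub d (fun q y => H (p + q) y) μ ({x}ᶜ) v →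
      ViscSuper d (fun q y => H (p + q) y) μ ({x}ᶜ) v →
      v = fun y => mMu d H μ y x - ⟪p, y - x⟫ := by
  have hH : GoodH d H := by
    refine ⟨hHcont, hreg_bdd, hreg_uc, hcoer, hqc, fun μ μ₁ h => ⟨Λ μ μ₁, ?_, fun q q' y h1 h2 => ?_⟩⟩
    · have := hΛstrict μ μ₁ h.ne'
      rwa [max_eq_left h.le] at this
    · exact (hsqc q q' y).trans (hΛmono _ _ _ _ h1 h2)
  have hF : GoodH d (fun q y => H (p + q) y) := hH.shift p
  obtain ⟨t, ⟨w, hw, rfl⟩, ht⟩ := exists_lt_of_csInf_lt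
    (s := {t | ∃ w ∈ Scal d, t = essSup (fun y => H (p + gradient w y) y) volume})
    ⟨_, fun _ => 0, zero_mem_Scal d, rfl⟩ hμ
  obtain ⟨μ', h1, h2⟩ := exists_between ht
  have hws : SubAE d (fun q y => H (p + q) y) μ' w := by
    refine ⟨hw.1.1, ?_⟩
    have := ae_lt_of_essSup_lt h1 (by
      obtain ⟨C, hC⟩ := hw.1.1
      obtain ⟨M, hM⟩ := hreg_bdd (‖p‖ + C + 1) (by positivity)
      refine isBoundedUnder_of ⟨M, fun y => ?_⟩
      have hg : ‖gradient w y‖ ≤ C := by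
        have := norm_fderiv_le_of_lipschitz ℝ hC (x₀ := y)
        rwa [← toDual_gradient, LinearIsometryEquiv.norm_map] at this
      have := hM (p + gradient w y) y ((norm_add_le _ _).trans (by linarith))
      exact (le_abs_self _).trans this)
    exact this.mono fun y hy => hy.le
  have hwμ : SubAE d (fun q y => H (p + q) y) μ w :=
    ⟨hws.1, hws.2.mono fun z hz => hz.trans h2.le⟩
  have hmeq : ∀ y, mMu d H μ y x - ⟪p, y - x⟫ = mMu d (fun q y => H (p + q) y) μ y x := by
    intro y
    apply le_antisymm
    · rw [sub_le_iff_le_add]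
      refine GoodH.m_le (sub_shift hwμ x) y x fun v hv => ?_
      have := hF.m_ge (sub_unshift hv x) y x
      simp only [sub_self, inner_zero_right, sub_zero] at this
      linarith
    · refine GoodH.m_le hwμ y x fun v hv => ?_
      have := hH.m_ge (sub_shift hv x) y x
      simp only [sub_self, inner_zero_right, add_zero] at this
      linarith
  have hfun : (fun y => mMu d H μ y x - ⟪p, y - x⟫) =
      fun y => mMu d (fun q y => H (p + q) y) μ y x := funext hmeq
  rw [hfun, hmeq x]
  exact hF.core hd hw hws h2 x
end
end
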